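/- Let m, n ≥ 4 be integers. Let f₁ ∈ ℂ[w₁,w₂,w₃] and f₂ ∈ ℂ[w₁,w₂,w₃] be homogeneous polynomials of degrees m and n respectively such that: (i) f₁(0,0,1) ≠ 0 and f₂(0,0,1) ≠ 0; (ii) the plane curves {f₁ = 0} and {f₂ = 0} are smooth, i.e. the gradient of fᵢ vanishes at no point of ℂ³∖{0} where fᵢ vanishes; (iii) for every (x₁,x₂) ∈ ℂ²∖{(0,0)}, each of the one-variable polynomials t ↦ f₁(x₁,x₂,t) and s ↦ f₂(x₁,x₂,s) has at least 3 distinct complex roots. Let f_∞ ∈ ℂ[z₁,z₂,z₃,z₄] be homogeneous of degree m+n such that: (iv) for every p = (p₁,p₂,p₃) ∈ ℂ³∖{0} with f₁(p) = 0, there exist at least 3 pairwise linearly independent vectors v ∈ ℂ⁴∖{0} lying in span_ℂ{(p₁,p₂,p₃,0),(0,0,0,1)} with f₁(v₁,v₂,v₃) = 0, f₂(v₁,v₂,v₄) = 0 and f_∞(v) ≠ 0; and (v) for every q = (q₁,q₂,q₄) ∈ ℂ³∖{0} with f₂(q) = 0, there exist at least 3 pairwise linearly independent vectors v ∈ ℂ⁴∖{0}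 lying in span_ℂ{(q₁,q₂,0,q₄),(0,0,1,0)} with f₁(v₁,v₂,v₃) = 0, f₂(v₁,v₂,v₄) = 0 and f_∞(v) ≠ 0. Then there exists ε > 0 such that for every t ∈ ℂ with 0 < |t| < ε, every holomorphic map g : ℂ → ℂ⁴ with g(w) ≠ 0 for all w and f₁(g₁(w),g₂(w),g₃(w))·f₂(g₁(w),g₂(w),g₄(w)) + t·f_∞(g(w)) = 0 for all w ∈ ℂ has pairwise linearly dependent values, i.e. g(w) and g(w′) are linearly dependent over ℂ for all w, w′ ∈ ℂ. -/

import Mathlib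

open MvPolynomial

section

open Filter Topology Metric

/-- The squared Hermitian norm of a vector. -/
noncomputable def nsq {ι : Type*} [Fintype ι] (p : ι → ℂ) : ℝ := ∑ i, ‖p i‖ ^ 2

/-- Twice the squared Hermitian norm of the bivector `p ∧ q`. -/
noncomputable def wsq {ι : Type*} [Fintype ι] (p q : ι → ℂ) : ℝ :=
  ∑ i, ∑ j, ‖p i * q j - p j * q i‖ ^ 2

section Algebra

variable {ι : Type*} [Fintype ι]

lemma nsq_nonneg (p : ι → ℂ) : 0 ≤ nsq p := Finset.sum_nonneg fun _ _ => by positivity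

lemma nsq_pos {p : ι → ℂ} (hp : p ≠ 0) : 0 < nsq p := by
  obtain ⟨i, hi⟩ := Function.ne_iff.1 hp
  refine Finset.sum_pos' (fun _ _ => by positivity) ⟨i, Finset.mem_univ _, ?_⟩
  have : p i ≠ 0 := by simpa using hi
  positivity

lemma nsq_smul (c : ℂ) (p : ι → ℂ) : nsq (c • p) = ‖c‖ ^ 2 * nsq p := by
  simp [nsq, Finset.mul_sum, mul_pow]

lemma norm_sq_le_nsq (p : ι → ℂ) (i : ι) : ‖p i‖ ^ 2 ≤ nsq p :=
  Finset.single_le_sum (f := fun i => ‖p i‖ ^ 2) (fun _ _ => by positivity) (Finset.mem_univ i)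

lemma continuous_nsq : Continuous (nsq : (ι → ℂ) → ℝ) := by
  unfold nsq; fun_prop

lemma wsq_nonneg (p q : ι → ℂ) : 0 ≤ wsq p q :=
  Finset.sum_nonneg fun _ _ => Finset.sum_nonneg fun _ _ => by positivity

lemma continuous_wsq : Continuous fun x : (ι → ℂ) × (ι → ℂ) => wsq x.1 x.2 := by
  unfold wsq; fun_prop

lemma wsq_eq_zero_iff {p q : ι → ℂ} : wsq p q = 0 ↔ ∀ i j, p i * q j = p j * q i := by
  unfold wsq
  rw [Finset.sum_eq_zero_iff_of_nonneg fun _ _ => Finset.sum_nonneg fun _ _ => by positivity]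
  simp only [Finset.mem_univ, true_imp_iff]
  refine forall_congr' fun i => ?_
  rw [Finset.sum_eq_zero_iff_of_nonneg fun _ _ => by positivity]
  simp [sub_eq_zero]

lemma wsq_smul_add (a b : ℂ) (p q : ι → ℂ) :
    wsq (a • p) (b • p + a • q) = ‖a‖ ^ 4 * wsq p q := by
  simp only [wsq, Finset.mul_sum]
  refine Finset.sum_congr rfl fun i _ => Finset.sum_congr rfl fun j _ => ?_
  have : (a • p) i * (b • p + a • q) j - (a • p) j * (b • p + a • q) i
      = a ^ 2 * (p i * q j - p j * q i) := by simp; ring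
  rw [this, norm_mul, norm_pow]; ring

/-- Lagrange's identity. -/
lemma wsq_eq (p q : ι → ℂ) :
    wsq p q = 2 * (nsq p * nsq q - ((∑ i, inner ℝ (p i) (q i)) ^ 2
      + (∑ i, inner ℝ (p i) (Complex.I * q i)) ^ 2)) := by
  have key : ∀ i j, ‖p i * q j - p j * q i‖ ^ 2
      = ‖p i‖ ^ 2 * ‖q j‖ ^ 2 + ‖p j‖ ^ 2 * ‖q i‖ ^ 2
        - 2 * (inner ℝ (p i) (q i) * inner ℝ (p j) (q j)
          + inner ℝ (p i) (Complex.I * q i) * inner ℝ (p j) (Complex.I * q j)) := by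
    intro i j
    simp only [← Complex.normSq_eq_norm_sq, Complex.normSq_apply, Complex.inner, Complex.mul_re,
      Complex.mul_im, Complex.sub_re, Complex.sub_im, Complex.conj_re, Complex.conj_im,
      Complex.I_re, Complex.I_im]
    ring
  simp only [wsq, key, Finset.sum_sub_distrib, Finset.sum_add_distrib, ← Finset.mul_sum,
    ← Finset.sum_mul, nsq]
  ring

end Algebra

section SecondDerivative

/-- `f` is twice differentiable at `0` with second derivative `a`. -/
def HasSecondDeriv (f : ℝ → ℝ) (a : ℝ) : Prop :=
  ∃ f' : ℝ → ℝ, (∀ᶠ s in 𝓝 0, HasDerivAt f (f' s) s) ∧ HasDerivAt f' a 0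

lemma HasSecondDeriv.add {f g : ℝ → ℝ} {a b : ℝ} (hf : HasSecondDeriv f a)
    (hg : HasSecondDeriv g b) : HasSecondDeriv (fun s => f s + g s) (a + b) := by
  obtain ⟨f', h1, h2⟩ := hf
  obtain ⟨g', h3, h4⟩ := hg
  exact ⟨fun s => f' s + g' s, by filter_upwards [h1, h3] with s a b using a.add b, h2.add h4⟩

lemma HasSecondDeriv.const_mul {f : ℝ → ℝ} {a : ℝ} (c : ℝ) (hf : HasSecondDeriv f a) :
    HasSecondDeriv (fun s => c * f s) (c * a) := by
  obtain ⟨f', h1, h2⟩ := hf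
  exact ⟨fun s => c * f' s, by filter_upwards [h1] with s a using a.const_mul c, h2.const_mul c⟩

lemma HasSecondDeriv.nonpos_of_isLocalMax {f : ℝ → ℝ} {a : ℝ} (hf : HasSecondDeriv f a)
    (hmax : IsLocalMax f 0) : a ≤ 0 := by
  obtain ⟨f', h1, h2⟩ := hf
  by_contra! ha
  have hd : deriv f =ᶠ[𝓝 0] f' := by filter_upwards [h1] with s hs using hs.deriv
  have hdd : deriv (deriv f) 0 = a := by rw [hd.deriv_eq, h2.deriv]
  have hmin : IsLocalMin f 0 :=
    isLocalMin_of_deriv_deriv_pos (by rwa [hdd]) hmax.deriv_eq_zero h1.self_of_nhds.continuousAt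
  have hconst : f =ᶠ[𝓝 0] fun _ => f 0 := by
    filter_upwards [hmax, hmin] with s h3 h4 using le_antisymm h3 h4
  have : deriv f =ᶠ[𝓝 0] fun _ => 0 := by
    filter_upwards [hconst.eventuallyEq_nhds] with s hs
    rw [hs.deriv_eq]; simp
  rw [this.deriv_eq] at hdd
  simp at hdd
  exact ha.ne hdd

lemma HasSecondDeriv.log {f f' : ℝ → ℝ} {a : ℝ} (h1 : ∀ᶠ s in 𝓝 0, HasDerivAt f (f' s) s)
    (h2 : HasDerivAt f' a 0) (h0 : f 0 ≠ 0) :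
    HasSecondDeriv (fun s => Real.log (f s)) ((a * f 0 - f' 0 ^ 2) / f 0 ^ 2) := by
  refine ⟨fun s => f' s / f s, ?_, ?_⟩
  · filter_upwards [h1, h1.self_of_nhds.continuousAt.eventually_ne h0] with s h3 h4
    exact h3.log h4
  · have := h2.div h1.self_of_nhds h0
    rwa [← pow_two] at this

lemma hasSecondDeriv_log_nsq {ι : Type*} [Fintype ι] {q : ℂ → ι → ℂ} {w : ℂ}
    (hq : AnalyticAt ℂ q w) (h0 : q w ≠ 0) (e : ℂ) :
    HasSecondDeriv (fun s : ℝ => Real.log (nsq (q (w + s * e))))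
      ((2 * (‖e‖ ^ 2 * nsq (deriv q w) + ∑ i, inner ℝ (q w i) (e ^ 2 * deriv (deriv q) w i))
        * nsq (q w) - (2 * ∑ i, inner ℝ (q w i) (e * deriv q w i)) ^ 2) / nsq (q w) ^ 2) := by
  have hl : ∀ s : ℝ, HasDerivAt (fun s : ℝ => w + s * e) e s := fun s => by
    simpa using ((Complex.ofRealCLM.hasDerivAt (x := s)).mul_const e).const_add w
  have ht : Tendsto (fun s : ℝ => w + s * e) (𝓝 0) (𝓝 w) := by
    have := (hl 0).continuousAt.tendsto
    simpa using this
  have hd : ∀ {r : ℂ → ι → ℂ} {s : ℝ}, AnalyticAt ℂ r (w + s * e) → ∀ i,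
      HasDerivAt (fun s : ℝ => r (w + s * e) i) (e * deriv r (w + s * e) i) s := by
    intro r s hr i
    have h := (hasDerivAt_pi.1 hr.differentiableAt.hasDerivAt i)
    simpa only [smul_eq_mul, Function.comp_def] using h.scomp s (hl s)
  have hN : ∀ᶠ s : ℝ in 𝓝 0, HasDerivAt (fun s : ℝ => nsq (q (w + s * e)))
      (2 * ∑ i, inner ℝ (q (w + s * e) i) (e * deriv q (w + s * e) i)) s := by
    filter_upwards [ht.eventually hq.eventually_analyticAt] with s hs
    unfold nsq
    rw [Finset.mul_sum]
    exact HasDerivAt.fun_sum fun i _ => (hd hs i).norm_sq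
  have hN2 : HasDerivAt
      (fun s : ℝ => 2 * ∑ i, inner ℝ (q (w + s * e) i) (e * deriv q (w + s * e) i))
      (2 * (‖e‖ ^ 2 * nsq (deriv q w) + ∑ i, inner ℝ (q w i) (e ^ 2 * deriv (deriv q) w i))) 0 := by
    refine HasDerivAt.const_mul _ ?_
    have hq0 : AnalyticAt ℂ q (w + (0 : ℝ) * e) := by simpa using hq
    have := HasDerivAt.fun_sum (u := Finset.univ) fun i _ =>
      (hd hq0 i).inner ℝ ((hd hq0.deriv i).const_mul e)
    refine this.congr_deriv ?_
    simp only [nsq, Finset.mul_sum, ← Finset.sum_add_distrib]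
    refine Finset.sum_congr rfl fun i _ => ?_
    rw [real_inner_self_eq_norm_sq, norm_mul, mul_pow, pow_two e, mul_assoc, add_comm]
    simp
  convert HasSecondDeriv.log hN hN2 (by simpa using (nsq_pos h0).ne') using 2 <;> simp

/-- The Laplacian of `log ‖q‖²` along the two coordinate directions. -/
lemma exists_hasSecondDeriv_log_nsq {ι : Type*} [Fintype ι] {q : ℂ → ι → ℂ} {w : ℂ}
    (hq : AnalyticAt ℂ q w) (h0 : q w ≠ 0) :
    ∃ a b : ℝ, HasSecondDeriv (fun s : ℝ => Real.log (nsq (q (w + s * 1)))) a ∧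
      HasSecondDeriv (fun s : ℝ => Real.log (nsq (q (w + s * Complex.I)))) b ∧
      a + b = 2 * wsq (q w) (deriv q w) / nsq (q w) ^ 2 := by
  refine ⟨_, _, hasSecondDeriv_log_nsq hq h0 1, hasSecondDeriv_log_nsq hq h0 Complex.I, ?_⟩
  have h : ∑ i, inner ℝ (q w i) (Complex.I ^ 2 * deriv (deriv q) w i)
      = -∑ i, inner ℝ (q w i) (1 ^ 2 * deriv (deriv q) w i) := by
    simp only [Complex.I_sq, neg_mul, one_pow, inner_neg_right, Finset.sum_neg_distrib]
  have : nsq (q w) ≠ 0 := (nsq_pos h0).ne'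
  rw [wsq_eq, h, norm_one, Complex.norm_I]
  simp only [one_mul]
  field_simp
  ring

end SecondDerivative

lemma exists_hasSecondDeriv_log_disc {R : ℝ} {w : ℂ} (hw : ‖w‖ < R) :
    ∃ a b : ℝ, HasSecondDeriv (fun s : ℝ => Real.log (R ^ 2 - ‖w + s * 1‖ ^ 2)) a ∧
      HasSecondDeriv (fun s : ℝ => Real.log (R ^ 2 - ‖w + s * Complex.I‖ ^ 2)) b ∧
      a + b = -(4 * R ^ 2 / (R ^ 2 - ‖w‖ ^ 2) ^ 2) := by
  have hpos : R ^ 2 - ‖w‖ ^ 2 ≠ 0 := by nlinarith [norm_nonneg w]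
  have key : ∀ c : ℝ, HasSecondDeriv (fun s : ℝ => Real.log (R ^ 2 - ‖w‖ ^ 2 - 2 * c * s - s ^ 2))
      ((-2 * (R ^ 2 - ‖w‖ ^ 2) - (2 * c) ^ 2) / (R ^ 2 - ‖w‖ ^ 2) ^ 2) := by
    intro c
    have h := HasSecondDeriv.log (f := fun s : ℝ => R ^ 2 - ‖w‖ ^ 2 - 2 * c * s - s ^ 2)
      (f' := fun s => - (2 * c) - 2 * s) (a := -2) ?_ ?_ (by simpa using hpos)
    · simpa using h
    · refine Eventually.of_forall fun s => ?_
      have := (((hasDerivAt_id s).const_mul (2 * c)).const_sub (R ^ 2 - ‖w‖ ^ 2)).sub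
        (hasDerivAt_pow 2 s)
      simpa using! this
    · simpa using ((hasDerivAt_id (0 : ℝ)).const_mul 2).const_sub (-(2 * c))
  have hn : ∀ z : ℂ, ‖z‖ ^ 2 = z.re ^ 2 + z.im ^ 2 := fun z => by
    rw [← Complex.normSq_eq_norm_sq, Complex.normSq_apply]; ring
  have h1 : (fun s : ℝ => Real.log (R ^ 2 - ‖w + s * 1‖ ^ 2))
      = fun s : ℝ => Real.log (R ^ 2 - ‖w‖ ^ 2 - 2 * w.re * s - s ^ 2) := by
    funext s; rw [hn, hn]; simp; ring_nf
  have h2 : (fun s : ℝ => Real.log (R ^ 2 - ‖w + s * Complex.I‖ ^ 2))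
      = fun s : ℝ => Real.log (R ^ 2 - ‖w‖ ^ 2 - 2 * w.im * s - s ^ 2) := by
    funext s; rw [hn, hn]; simp; ring_nf
  refine ⟨_, _, h1 ▸ key w.re, h2 ▸ key w.im, ?_⟩
  field_simp
  rw [hn]
  ring

/-- Locally, `h` is the conformal factor `‖η‖² ‖q‖²ᵏ` of a holomorphic metric whose
curvature is at most a negative constant at the base point. -/
def IsNegativelyCurvedAt {ι : Type*} [Fintype ι] (h : ℂ → ℝ) (c : ℝ) (k : ℕ)
    (η : ℂ → ℂ) (q : ℂ → ι → ℂ) (w : ℂ) : Prop :=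
  AnalyticAt ℂ η w ∧ AnalyticAt ℂ q w ∧ q w ≠ 0 ∧
    (∀ᶠ z in 𝓝 w, h z = ‖η z‖ ^ 2 * nsq (q z) ^ k) ∧
    c * ‖η w‖ ^ 2 * nsq (q w) ^ (k + 2) ≤ wsq (q w) (deriv q w)

lemma IsNegativelyCurvedAt.le_of_isLocalMax {ι : Type*} [Fintype ι] {h : ℂ → ℝ} {c : ℝ}
    (hc : 0 < c) {k : ℕ} (hk : 1 ≤ k) {η : ℂ → ℂ} {q : ℂ → ι → ℂ} {w : ℂ} {R : ℝ}
    (H : IsNegativelyCurvedAt h c k η q w) (hw : ‖w‖ < R) (hpos : 0 < h w)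
    (hmax : IsLocalMax (fun z => h z * (R ^ 2 - ‖z‖ ^ 2) ^ 2) w) :
    h w * (R ^ 2 - ‖w‖ ^ 2) ^ 2 ≤ 4 * R ^ 2 / c := by
  obtain ⟨hη, hq, hq0, hh, hcurv⟩ := H
  have hη0 : η w ≠ 0 := by
    intro h0
    rw [hh.self_of_nhds, h0] at hpos
    simp at hpos
  have hV : 0 < R ^ 2 - ‖w‖ ^ 2 := by nlinarith [norm_nonneg w]
  have hq' : AnalyticAt ℂ (fun z (_ : Unit) => η z) w := by
    rw [analyticAt_pi_iff]; intro _; exact hη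
  obtain ⟨a₁, b₁, ha₁, hb₁, h₁⟩ := exists_hasSecondDeriv_log_nsq hq'
    (by intro h; exact hη0 (congrFun h ()))
  obtain ⟨a₂, b₂, ha₂, hb₂, h₂⟩ := exists_hasSecondDeriv_log_nsq hq hq0
  obtain ⟨a₃, b₃, ha₃, hb₃, h₃⟩ := exists_hasSecondDeriv_log_disc hw
  have h₁' : a₁ + b₁ = 0 := by
    rw [h₁, wsq_eq_zero_iff.2 (by simp)]; simp
  have hlog : ∀ᶠ z in 𝓝 w, Real.log (h z * (R ^ 2 - ‖z‖ ^ 2) ^ 2)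
      = Real.log (nsq (fun _ : Unit => η z)) + k * Real.log (nsq (q z))
        + 2 * Real.log (R ^ 2 - ‖z‖ ^ 2) := by
    have e1 : ∀ᶠ z in 𝓝 w, 0 < R ^ 2 - ‖z‖ ^ 2 := by
      refine ContinuousAt.eventually_lt continuousAt_const ?_ hV
      fun_prop
    filter_upwards [hh, hη.continuousAt.eventually_ne hη0, hq.continuousAt.eventually_ne hq0, e1]
      with z h1 h2 h3 h4
    have h3' := (nsq_pos h3).ne'
    rw [h1, Real.log_mul, Real.log_mul, Real.log_pow, Real.log_pow]
    · simp [nsq]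
    all_goals positivity
  have hmaxlog : IsLocalMax (fun z => Real.log (nsq (fun _ : Unit => η z))
      + k * Real.log (nsq (q z)) + 2 * Real.log (R ^ 2 - ‖z‖ ^ 2)) w := by
    have e1 : ∀ᶠ z in 𝓝 w, 0 < h z * (R ^ 2 - ‖z‖ ^ 2) ^ 2 := by
      have e2 : ∀ᶠ z in 𝓝 w, 0 < R ^ 2 - ‖z‖ ^ 2 := by
        refine ContinuousAt.eventually_lt continuousAt_const ?_ hV
        fun_prop
      filter_upwards [hh, hη.continuousAt.eventually_ne hη0,
        hq.continuousAt.eventually_ne hq0, e2] with z h1 h2 h3 h4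
      have h3' := nsq_pos h3
      rw [h1]
      positivity
    filter_upwards [hlog, hmax, e1] with z h1 h2 h3
    rw [← h1, ← hlog.self_of_nhds]
    exact Real.log_le_log h3 h2
  have hline : ∀ e : ℂ, Tendsto (fun s : ℝ => w + s * e) (𝓝 0) (𝓝 w) := fun e => by
    have : Continuous fun s : ℝ => w + s * e := by fun_prop
    simpa using this.tendsto 0
  have ineq : ∀ (e : ℂ) (a b d : ℝ),
      HasSecondDeriv (fun s : ℝ => Real.log (nsq (fun _ : Unit => η (w + s * e)))) a →
      HasSecondDeriv (fun s : ℝ => Real.log (nsq (q (w + s * e)))) b →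
      HasSecondDeriv (fun s : ℝ => Real.log (R ^ 2 - ‖w + s * e‖ ^ 2)) d →
      a + k * b + 2 * d ≤ 0 := by
    intro e a b d ha hb hd
    refine ((ha.add (hb.const_mul k)).add (hd.const_mul 2)).nonpos_of_isLocalMax ?_
    have := (hline e).eventually hmaxlog
    simpa [IsLocalMax, IsMaxFilter] using this
  have i1 := ineq 1 a₁ a₂ a₃ ha₁ ha₂ ha₃
  have i2 := ineq Complex.I b₁ b₂ b₃ hb₁ hb₂ hb₃
  have hN := nsq_pos hq0
  have hk' : (1 : ℝ) ≤ k := by exact_mod_cast hk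
  have i3 : (k : ℝ) * (2 * wsq (q w) (deriv q w) / nsq (q w) ^ 2)
      ≤ 2 * (4 * R ^ 2 / (R ^ 2 - ‖w‖ ^ 2) ^ 2) := by
    rw [← h₂]; linarith
  have i4 : 2 * (c * h w) ≤ 2 * wsq (q w) (deriv q w) / nsq (q w) ^ 2 := by
    rw [hh.self_of_nhds, le_div_iff₀ (by positivity)]
    calc _ = 2 * (c * ‖η w‖ ^ 2 * nsq (q w) ^ (k + 2)) := by ring
      _ ≤ _ := by linarith
  have i5 : 2 * (c * h w) ≤ 2 * (4 * R ^ 2 / (R ^ 2 - ‖w‖ ^ 2) ^ 2) := by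
    have : 0 ≤ 2 * (c * h w) := by positivity
    nlinarith
  rw [le_div_iff₀ hc]
  have i6 : c * h w ≤ 4 * R ^ 2 / (R ^ 2 - ‖w‖ ^ 2) ^ 2 := by linarith
  rw [le_div_iff₀ (by positivity)] at i6
  linarith

/-- **Ahlfors' lemma** on the whole plane: a pseudo-metric with curvature bounded above by a
negative constant vanishes. -/
theorem eq_zero_of_isNegativelyCurvedAt {ι : Type*} [Fintype ι] {h : ℂ → ℝ} {c : ℝ} (hc : 0 < c)
    {k : ℕ} (hk : 1 ≤ k)
    (H : ∀ w, ∃ (η : ℂ → ℂ) (q : ℂ → ι → ℂ), IsNegativelyCurvedAt h c k η q w) (w : ℂ) :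
    h w = 0 := by
  have hnonneg : ∀ w, 0 ≤ h w := fun w => by
    obtain ⟨η, q, -, -, -, h1, -⟩ := H w
    rw [h1.self_of_nhds]
    have := nsq_nonneg (q w)
    positivity
  have hcont : Continuous h := by
    rw [continuous_iff_continuousAt]
    intro w
    obtain ⟨η, q, hη, hq, -, h1, -⟩ := H w
    refine ContinuousAt.congr_of_eventuallyEq ?_ h1
    have h2 := continuous_nsq.continuousAt.comp hq.continuousAt
    exact (hη.continuousAt.norm.pow 2).mul (h2.pow k)
  have bound : ∀ R, ‖w‖ < R → h w * (R ^ 2 - ‖w‖ ^ 2) ^ 2 ≤ 4 * R ^ 2 / c := by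
    intro R hR
    have hR0 : 0 < R := (norm_nonneg w).trans_lt hR
    obtain ⟨z, hz, hmax⟩ := (isCompact_closedBall (0 : ℂ) R).exists_isMaxOn
      ⟨0, by simp [hR0.le]⟩
      (f := fun z => h z * (R ^ 2 - ‖z‖ ^ 2) ^ 2) (by fun_prop)
    have hwz : h w * (R ^ 2 - ‖w‖ ^ 2) ^ 2 ≤ h z * (R ^ 2 - ‖z‖ ^ 2) ^ 2 :=
      hmax (by simpa using hR.le)
    rcases (hnonneg z).eq_or_lt with hz0 | hz0
    · rw [← hz0, zero_mul] at hwz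
      exact hwz.trans (by positivity)
    rcases (mem_closedBall_zero_iff.1 hz).eq_or_lt with hzR | hzR
    · rw [hzR, sub_self] at hwz
      refine hwz.trans ?_
      simp only [ne_eq, OfNat.ofNat_ne_zero, not_false_eq_true, zero_pow, mul_zero]
      positivity
    · obtain ⟨η, q, hq⟩ := H z
      refine hwz.trans (hq.le_of_isLocalMax hc hk hzR hz0 ?_)
      exact hmax.isLocalMax (closedBall_mem_nhds_of_mem (by simpa using hzR))
  by_contra hne
  have hpos : 0 < h w := (hnonneg w).lt_of_ne (Ne.symm hne)
  obtain ⟨R, hR⟩ : ∃ R : ℝ, R = ‖w‖ + 1 + 8 / (c * h w) := ⟨_, rfl⟩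
  have hd : 0 < 8 / (c * h w) := by positivity
  have h1 := bound R (by linarith)
  rw [le_div_iff₀ hc] at h1
  have hch : 0 < c * h w := by positivity
  have h2 : R * (R - ‖w‖) ≤ R ^ 2 - ‖w‖ ^ 2 := by nlinarith [norm_nonneg w]
  have h3 : (R * (R - ‖w‖)) ^ 2 ≤ (R ^ 2 - ‖w‖ ^ 2) ^ 2 := by
    refine pow_le_pow_left₀ ?_ h2 2
    exact mul_nonneg (by linarith [norm_nonneg w]) (by linarith)
  have h4 : 8 / (c * h w) ≤ (R - ‖w‖) ^ 2 := by
    rw [hR]; nlinarith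
  have hR2 : 0 < R ^ 2 := by
    have : 0 < R := by linarith [norm_nonneg w]
    positivity
  have h5 : 8 ≤ c * h w * (R - ‖w‖) ^ 2 := by
    rw [div_le_iff₀ hch] at h4; linarith
  have h6 : c * h w * (R * (R - ‖w‖)) ^ 2 ≤ 4 * R ^ 2 := by
    calc _ ≤ c * h w * (R ^ 2 - ‖w‖ ^ 2) ^ 2 := by gcongr
      _ ≤ _ := by linarith
  nlinarith

section Polynomials

set_option linter.unusedSectionVars false

variable {σ : Type*} [Fintype σ]

lemma MvPolynomial.IsHomogeneous.eval_smul {f : MvPolynomial σ ℂ} {n : ℕ}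
    (hf : f.IsHomogeneous n) (c : ℂ) (x : σ → ℂ) : eval (c • x) f = c ^ n * eval x f := by
  rw [eval_eq', eval_eq', Finset.mul_sum]
  refine Finset.sum_congr rfl fun d hd => ?_
  have h : ∑ i, d i = n := by
    rw [← hf (mem_support_iff.1 hd), Finsupp.weight_apply, Finsupp.sum_fintype _ _ (by simp)]
    simp
  simp only [Pi.smul_apply, smul_eq_mul, mul_pow, Finset.prod_mul_distrib, Finset.prod_pow_eq_pow_sum, h]
  ring

lemma MvPolynomial.IsHomogeneous.eval_smul_eq_zero_iff {f : MvPolynomial σ ℂ} {n : ℕ}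
    (hf : f.IsHomogeneous n) {c : ℂ} (hc : c ≠ 0) (x : σ → ℂ) :
    eval (c • x) f = 0 ↔ eval x f = 0 := by
  rw [hf.eval_smul]; simp [hc]

lemma HasDerivAt.eval_mvPolynomial (f : MvPolynomial σ ℂ) {q : ℂ → σ → ℂ} {q' : σ → ℂ} {w : ℂ}
    (h : HasDerivAt q q' w) :
    HasDerivAt (fun z => eval (q z) f) (∑ i, eval (q w) (pderiv i f) * q' i) w := by
  classical
  induction f using MvPolynomial.induction_on with
  | C a => simpa using hasDerivAt_const w a
  | add p r hp hr =>
    simp only [map_add, add_mul, Finset.sum_add_distrib]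
    exact hp.add hr
  | mul_X p j hp =>
    have hj := hasDerivAt_pi.1 h j
    have := hp.mul hj
    simp only [map_mul, eval_X]
    refine this.congr_deriv ?_
    simp only [pderiv_mul, pderiv_X, map_add, map_mul, eval_X, add_mul, Finset.sum_add_distrib,
      Finset.sum_mul]
    congr 1
    · exact Finset.sum_congr rfl fun i _ => by ring
    · rw [Finset.sum_eq_single j]
      · simp
      · intro i _ hi
        simp [hi.symm]
      · simp

lemma AnalyticAt.eval_mvPolynomial' {q : ℂ → σ → ℂ} {w : ℂ} (h : AnalyticAt ℂ q w)
    (f : MvPolynomial σ ℂ) : AnalyticAt ℂ (fun z => eval (q z) f) w := by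
  rw [Complex.analyticAt_iff_eventually_differentiableAt] at h ⊢
  filter_upwards [h] with z hz using (hz.hasDerivAt.eval_mvPolynomial f).differentiableAt

lemma MvPolynomial.IsHomogeneous.sum_mul_eval_pderiv {f : MvPolynomial σ ℂ} {n : ℕ}
    (hf : f.IsHomogeneous n) (x : σ → ℂ) :
    ∑ i, eval x (pderiv i f) * x i = n * eval x f := by
  have := congrArg (eval x) hf.sum_X_mul_pderiv
  simpa [map_sum, mul_comm] using this

/-- The gradient of a polynomial. -/
noncomputable def grad (f : MvPolynomial σ ℂ) (x : σ → ℂ) : σ → ℂ := fun i => eval x (pderiv i f)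

lemma continuous_grad (f : MvPolynomial σ ℂ) : Continuous (grad f) :=
  continuous_pi fun _ => MvPolynomial.continuous_eval _

lemma MvPolynomial.IsHomogeneous.grad_smul {f : MvPolynomial σ ℂ} {n : ℕ}
    (hf : f.IsHomogeneous n) (c : ℂ) (x : σ → ℂ) : grad f (c • x) = c ^ (n - 1) • grad f x := by
  funext i
  simp [grad, hf.pderiv.eval_smul]

/-- A projective hypersurface is smooth if the gradient of its equation does not vanish on it. -/
def IsSmooth (f : MvPolynomial σ ℂ) : Prop :=
  ∀ x : σ → ℂ, x ≠ 0 → eval x f = 0 → ∃ i, eval x (pderiv i f) ≠ 0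

lemma IsSmooth.grad_ne_zero {f : MvPolynomial σ ℂ} (hs : IsSmooth f) {x : σ → ℂ} (hx : x ≠ 0)
    (h : eval x f = 0) : grad f x ≠ 0 := by
  obtain ⟨i, hi⟩ := hs x hx h
  exact fun h0 => hi (congrFun h0 i)

lemma IsSmooth.exists_le_nsq_grad {f : MvPolynomial σ ℂ} {n : ℕ} (hf : f.IsHomogeneous n)
    (hs : IsSmooth f) :
    ∃ c > 0, ∀ x : σ → ℂ, x ≠ 0 → eval x f = 0 → c * nsq x ^ (n - 1) ≤ nsq (grad f x) := by
  set K : Set (σ → ℂ) := {x | nsq x = 1 ∧ eval x f = 0}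
  have hK : IsCompact K := by
    refine (isCompact_closedBall (0 : σ → ℂ) 1).of_isClosed_subset
      ((isClosed_eq continuous_nsq continuous_const).inter
        (isClosed_eq (MvPolynomial.continuous_eval f) continuous_const)) ?_
    rintro x ⟨hx, -⟩
    rw [mem_closedBall_zero_iff, pi_norm_le_iff_of_nonneg zero_le_one]
    intro i
    have := norm_sq_le_nsq x i
    rw [hx] at this
    exact (sq_le_one_iff₀ (norm_nonneg _)).1 this
  obtain ⟨c, hc, hcK⟩ : ∃ c > 0, ∀ x ∈ K, c ≤ nsq (grad f x) := by
    rcases K.eq_empty_or_nonempty with h | h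
    · exact ⟨1, one_pos, by simp [h]⟩
    · obtain ⟨y, hy, hmin⟩ := hK.exists_isMinOn h
        (continuous_nsq.comp (continuous_grad f)).continuousOn
      refine ⟨nsq (grad f y), nsq_pos (hs.grad_ne_zero ?_ hy.2), fun x hx => hmin hx⟩
      rintro rfl
      simpa [nsq] using hy.1
  refine ⟨c, hc, fun x hx h0 => ?_⟩
  have hN := nsq_pos hx
  set r : ℝ := √(nsq x)
  have hr : 0 < r := Real.sqrt_pos.2 hN
  have hr2 : r ^ 2 = nsq x := Real.sq_sqrt hN.le
  set y : σ → ℂ := ((r⁻¹ : ℝ) : ℂ) • x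
  have hxy : x = ((r : ℝ) : ℂ) • y := by
    simp only [y, smul_smul]
    rw [← Complex.ofReal_mul, mul_inv_cancel₀ hr.ne']; simp
  have hy : y ∈ K := by
    refine ⟨?_, ?_⟩
    · simp only [y, nsq_smul, Complex.norm_real, norm_inv, Real.norm_of_nonneg hr.le, ← hr2]
      field_simp
    · rw [hf.eval_smul, h0, mul_zero]
  have h1 := hcK y hy
  have h2 : nsq (grad f x) = nsq x ^ (n - 1) * nsq (grad f y) := by
    rw [hxy, hf.grad_smul, ← hxy, nsq_smul, norm_pow, Complex.norm_real,
      Real.norm_of_nonneg hr.le, ← hr2]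
    ring
  rw [h2, mul_comm]
  gcongr

end Polynomials

/-- The conformal factor of the canonical metric on the plane curve `f = 0` of degree `m`,
evaluated on the tangent vector `p'` at `p`. -/
noncomputable def canonicalMetric (f : MvPolynomial (Fin 3) ℂ) (m : ℕ) (p p' : Fin 3 → ℂ) : ℝ :=
  wsq p p' / (2 * nsq (grad f p)) * nsq p ^ (m - 3)

lemma canonicalMetric_smul {f : MvPolynomial (Fin 3) ℂ} {m : ℕ} (hm : 3 ≤ m)
    (hf : f.IsHomogeneous m) {a : ℂ} (ha : a ≠ 0) (b : ℂ) (p p' : Fin 3 → ℂ) :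
    canonicalMetric f m (a • p) (b • p + a • p') = canonicalMetric f m p p' := by
  have ha' : ‖a‖ ≠ 0 := by simpa using ha
  obtain ⟨k, rfl⟩ := Nat.exists_eq_add_of_le hm
  have e1 : 3 + k - 1 = k + 2 := by omega
  have e2 : 3 + k - 3 = k := by omega
  rw [canonicalMetric, canonicalMetric, wsq_smul_add, hf.grad_smul, nsq_smul, nsq_smul, norm_pow,
    e1, e2, mul_pow]
  by_cases h : nsq (grad f p) = 0
  · simp [h]
  field_simp
  ring

lemma wsq_eq_of_cross {p q F : Fin 3 → ℂ} {η : ℂ} (h0 : p 1 * q 2 - p 2 * q 1 = η * F 0)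
    (h1 : p 2 * q 0 - p 0 * q 2 = η * F 1) (h2 : p 0 * q 1 - p 1 * q 0 = η * F 2) :
    wsq p q = 2 * (‖η‖ ^ 2 * nsq F) := by
  have n0 : p 2 * q 1 - p 1 * q 2 = -(η * F 0) := by rw [← h0]; ring
  have n1 : p 0 * q 2 - p 2 * q 0 = -(η * F 1) := by rw [← h1]; ring
  have n2 : p 1 * q 0 - p 0 * q 1 = -(η * F 2) := by rw [← h2]; ring
  simp only [wsq, nsq, Fin.sum_univ_three, h0, h1, h2, n0, n1, n2, norm_neg, norm_mul, sub_self,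
    norm_zero]
  ring

/-- Two vectors orthogonal to `F` have cross product proportional to `F`. -/
lemma exists_cross_eq {p q F : Fin 3 → ℂ} {i : Fin 3} (hp : ∑ j, F j * p j = 0)
    (hq : ∑ j, F j * q j = 0) (hi : F i ≠ 0) :
    let η := (p (i + 1) * q (i + 2) - p (i + 2) * q (i + 1)) / F i
    p 1 * q 2 - p 2 * q 1 = η * F 0 ∧ p 2 * q 0 - p 0 * q 2 = η * F 1 ∧
      p 0 * q 1 - p 1 * q 0 = η * F 2 := by
  intro η
  have hη : η * F i = p (i + 1) * q (i + 2) - p (i + 2) * q (i + 1) := div_mul_cancel₀ _ hi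
  clear_value η
  rw [Fin.sum_univ_three] at hp hq
  have c01 : F 0 * (p 2 * q 0 - p 0 * q 2) = F 1 * (p 1 * q 2 - p 2 * q 1) := by
    linear_combination p 2 * hq - q 2 * hp
  have c12 : F 1 * (p 0 * q 1 - p 1 * q 0) = F 2 * (p 2 * q 0 - p 0 * q 2) := by
    linear_combination p 0 * hq - q 0 * hp
  have c20 : F 2 * (p 1 * q 2 - p 2 * q 1) = F 0 * (p 0 * q 1 - p 1 * q 0) := by
    linear_combination p 1 * hq - q 1 * hp
  fin_cases i
  · have h' : η * F 0 = p 1 * q 2 - p 2 * q 1 := hη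
    have hi : F 0 ≠ 0 := hi
    refine ⟨h'.symm, mul_left_cancel₀ hi ?_, mul_left_cancel₀ hi ?_⟩
    · linear_combination c01 - F 1 * h'
    · linear_combination -c20 - F 2 * h'
  · have h' : η * F 1 = p 2 * q 0 - p 0 * q 2 := hη
    have hi : F 1 ≠ 0 := hi
    refine ⟨mul_left_cancel₀ hi ?_, h'.symm, mul_left_cancel₀ hi ?_⟩
    · linear_combination -c01 - F 0 * h'
    · linear_combination c12 - F 2 * h'
  · have h' : η * F 2 = p 0 * q 1 - p 1 * q 0 := hη
    have hi : F 2 ≠ 0 := hi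
    refine ⟨mul_left_cancel₀ hi ?_, mul_left_cancel₀ hi ?_, h'.symm⟩
    · linear_combination c20 - F 0 * h'
    · linear_combination -c12 - F 1 * h'

/-- The canonical metric of a smooth plane curve of degree at least four is negatively curved. -/
lemma IsSmooth.isNegativelyCurvedAt {f : MvPolynomial (Fin 3) ℂ} {m : ℕ} (hm : 4 ≤ m)
    (hf : f.IsHomogeneous m) (hs : IsSmooth f) {c : ℝ}
    (hc : ∀ x : Fin 3 → ℂ, x ≠ 0 → eval x f = 0 → c * nsq x ^ (m - 1) ≤ nsq (grad f x))
    {q : ℂ → Fin 3 → ℂ} {w : ℂ} (hq : AnalyticAt ℂ q w) (hq0 : q w ≠ 0)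
    (hfq : ∀ᶠ z in 𝓝 w, eval (q z) f = 0) {h : ℂ → ℝ}
    (hh : ∀ᶠ z in 𝓝 w, h z = canonicalMetric f m (q z) (deriv q z)) :
    ∃ η : ℂ → ℂ, IsNegativelyCurvedAt h (2 * c) (m - 3) η q w := by
  obtain ⟨i, hi⟩ := hs _ hq0 hfq.self_of_nhds
  have hqi : ∀ i, AnalyticAt ℂ (fun z => q z i) w := analyticAt_pi_iff.1 hq
  have hqi' : ∀ i, AnalyticAt ℂ (fun z => deriv q z i) w := analyticAt_pi_iff.1 hq.deriv
  have hF : AnalyticAt ℂ (fun z => grad f (q z) i) w := hq.eval_mvPolynomial' _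
  set η : ℂ → ℂ := fun z => (q z (i + 1) * deriv q z (i + 2) - q z (i + 2) * deriv q z (i + 1))
    / grad f (q z) i
  have hη : AnalyticAt ℂ η w :=
    (((hqi _).mul (hqi' _)).sub ((hqi _).mul (hqi' _))).div hF hi
  have key : ∀ᶠ z in 𝓝 w, wsq (q z) (deriv q z) = 2 * (‖η z‖ ^ 2 * nsq (grad f (q z))) := by
    filter_upwards [hfq.eventually_nhds, hF.continuousAt.eventually_ne hi,
      hq.eventually_analyticAt] with z h1 h2 h3
    have e1 : ∑ j, grad f (q z) j * q z j = 0 := by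
      have := hf.sum_mul_eval_pderiv (q z)
      rwa [h1.self_of_nhds, mul_zero] at this
    have e2 : ∑ j, grad f (q z) j * deriv q z j = 0 := by
      have e3 := h3.differentiableAt.hasDerivAt.eval_mvPolynomial f
      have e4 : (fun z => eval (q z) f) =ᶠ[𝓝 z] fun _ => 0 := h1
      have := e4.deriv_eq
      rw [e3.deriv, deriv_const] at this
      exact this
    obtain ⟨k0, k1, k2⟩ := exists_cross_eq e1 e2 h2
    exact wsq_eq_of_cross k0 k1 k2
  refine ⟨η, hη, hq, hq0, ?_, ?_⟩
  · filter_upwards [hh, key, hfq, hq.continuousAt.eventually_ne hq0] with z h1 h2 h3 h4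
    have := (nsq_pos (hs.grad_ne_zero h4 h3)).ne'
    rw [h1, canonicalMetric, h2]
    field_simp
  · rw [key.self_of_nhds, show m - 3 + 2 = m - 1 by omega]
    have := hc _ hq0 hfq.self_of_nhds
    have : ‖η w‖ ^ 2 * (c * nsq (q w) ^ (m - 1)) ≤ ‖η w‖ ^ 2 * nsq (grad f (q w)) := by gcongr
    linarith

section

/-- If a property holds or fails near every point of the plane, then it holds near every point as
soon as it holds near one. -/
lemma eventually_nhdsNE_of_dichotomy {p : ℂ → Prop}
    (H : ∀ w, (∀ᶠ z in 𝓝[≠] w, p z) ∨ ∀ᶠ z in 𝓝[≠] w, ¬ p z) {a : ℂ}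
    (ha : ∀ᶠ z in 𝓝[≠] a, p z) (b : ℂ) : ∀ᶠ z in 𝓝[≠] b, p z := by
  have hopen : ∀ r : ℂ → Prop, IsOpen {w | ∀ᶠ z in 𝓝[≠] w, r z} := by
    intro r
    rw [isOpen_iff_eventually]
    intro w hw
    have h1 : ∀ᶠ z in 𝓝[≠] w, ∀ᶠ y in 𝓝[≠] z, r y := by
      have h2 := eventually_eventually_nhdsWithin.2 hw
      filter_upwards [h2, self_mem_nhdsWithin] with z hz hzw
      rw [IsOpen.nhdsWithin_eq isOpen_compl_singleton hzw] at hz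
      exact hz.filter_mono nhdsWithin_le_nhds
    rw [eventually_nhdsWithin_iff] at h1
    filter_upwards [h1] with z hz
    by_cases h : z = w
    · rw [h]; exact hw
    · exact hz h
  have hclopen : IsClopen {w | ∀ᶠ z in 𝓝[≠] w, p z} := by
    refine ⟨⟨?_⟩, hopen p⟩
    convert hopen (fun z => ¬ p z) using 1
    ext w
    refine ⟨fun h => (H w).resolve_left h, fun h1 h2 => ?_⟩
    have h2 : ∀ᶠ z in 𝓝[≠] w, p z := h2
    obtain ⟨z, hz1, hz2⟩ := (h2.and h1).exists
    exact hz2 hz1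
  have hb : b ∈ {w | ∀ᶠ z in 𝓝[≠] w, p z} := by
    rw [hclopen.eq_univ ⟨a, ha⟩]; trivial
  exact hb

/-- The projective classes of `P w` are given locally, off isolated points, by a nonvanishing
holomorphic map. -/
def IsProjCurve {ι : Type*} [Fintype ι] (P : ℂ → ι → ℂ) : Prop :=
  ∀ w, ∃ q : ℂ → ι → ℂ, AnalyticAt ℂ q w ∧ q w ≠ 0 ∧
    ∀ᶠ z in 𝓝[≠] w, ∃ c : ℂ, c ≠ 0 ∧ P z = c • q z

variable {ι : Type*} [Fintype ι]

lemma IsProjCurve.eventually_eval_eq_zero {P : ℂ → ι → ℂ} (hP : IsProjCurve P)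
    {F : MvPolynomial ι ℂ} {n : ℕ} (hF : F.IsHomogeneous n) {a : ℂ}
    (ha : ∀ᶠ z in 𝓝[≠] a, eval (P z) F = 0) (b : ℂ) : ∀ᶠ z in 𝓝[≠] b, eval (P z) F = 0 := by
  refine eventually_nhdsNE_of_dichotomy (fun w => ?_) ha b
  obtain ⟨q, hq, -, hPq⟩ := hP w
  rcases (hq.eval_mvPolynomial' F).eventually_eq_zero_or_eventually_ne_zero with h | h
  · left
    filter_upwards [hPq, nhdsWithin_le_nhds h] with z ⟨c, hc, hz⟩ h0
    rw [hz, hF.eval_smul_eq_zero_iff hc, h0]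
  · right
    filter_upwards [hPq, h] with z ⟨c, hc, hz⟩ h0
    rwa [hz, hF.eval_smul_eq_zero_iff hc]

/-- Two nonvanishing germs that are parallel off a point differ by an invertible factor. -/
lemma AnalyticAt.exists_eventuallyEq_smul {q r : ℂ → ι → ℂ} {w : ℂ} (hq : AnalyticAt ℂ q w)
    (hr : AnalyticAt ℂ r w) (hq0 : q w ≠ 0) (hr0 : r w ≠ 0)
    (h : ∀ᶠ z in 𝓝[≠] w, ∃ c : ℂ, q z = c • r z) :
    ∃ l : ℂ → ℂ, AnalyticAt ℂ l w ∧ l w ≠ 0 ∧ ∀ᶠ z in 𝓝 w, q z = l z • r z := by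
  have hqi : ∀ i, AnalyticAt ℂ (fun z => q z i) w := analyticAt_pi_iff.1 hq
  have hri : ∀ i, AnalyticAt ℂ (fun z => r z i) w := analyticAt_pi_iff.1 hr
  obtain ⟨i, hi⟩ := Function.ne_iff.1 hr0
  have hi : r w i ≠ 0 := hi
  have key : ∀ᶠ z in 𝓝 w, q z = (q z i / r z i) • r z := by
    have h1 : ∀ᶠ z in 𝓝[≠] w, ∀ j, q z j * r z i - q z i * r z j = 0 := by
      filter_upwards [h] with z ⟨c, hc⟩ j
      simp only [hc, Pi.smul_apply, smul_eq_mul]; ring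
    have h2 : ∀ᶠ z in 𝓝 w, ∀ j, q z j * r z i - q z i * r z j = 0 := by
      rw [eventually_all] at h1 ⊢
      intro j
      have h3 : AnalyticAt ℂ (fun z => q z j * r z i - q z i * r z j) w :=
        ((hqi j).mul (hri i)).sub ((hqi i).mul (hri j))
      exact h3.frequently_zero_iff_eventually_zero.1 (h1 j).frequently
    filter_upwards [h2, (hri i).continuousAt.eventually_ne hi] with z hz hz0
    funext j
    have := hz j
    simp only [Pi.smul_apply, smul_eq_mul]
    field_simp
    linear_combination this
  refine ⟨fun z => q z i / r z i, (hqi i).div (hri i) hi, fun h0 => hq0 ?_, key⟩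
  have := key.self_of_nhds
  simp only at h0
  rw [this, h0, zero_smul]

/-- A projective germ with vanishing Wronskians is constant. -/
lemma exists_eventuallyEq_smul_of_wsq_eq_zero {q : ℂ → ι → ℂ} {w : ℂ} (hq : AnalyticAt ℂ q w)
    (hq0 : q w ≠ 0) (h : ∀ᶠ z in 𝓝 w, wsq (q z) (deriv q z) = 0) :
    ∃ v : ι → ℂ, v ≠ 0 ∧ ∀ᶠ z in 𝓝 w, ∃ c : ℂ, c ≠ 0 ∧ q z = c • v := by
  obtain ⟨i, hi⟩ := Function.ne_iff.1 hq0
  have hi : q w i ≠ 0 := hi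
  have hqi : ∀ i, AnalyticAt ℂ (fun z => q z i) w := analyticAt_pi_iff.1 hq
  obtain ⟨r, hr, hball⟩ := eventually_nhds_iff_ball.1
    ((h.and hq.eventually_analyticAt).and ((hqi i).continuousAt.eventually_ne hi))
  have hconst : ∀ z ∈ ball w r, ∀ j, q z j / q z i = q w j / q w i := by
    intro z hz j
    have hd : ∀ y ∈ ball w r, HasDerivAt (fun z => q z j / q z i) 0 y := by
      intro y hy
      obtain ⟨⟨h1, h2⟩, h3⟩ := hball y hy
      have h4 := hasDerivAt_pi.1 h2.differentiableAt.hasDerivAt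
      refine ((h4 j).div (h4 i) h3).congr_deriv ?_
      rw [div_eq_zero_iff]
      left
      linear_combination (wsq_eq_zero_iff.1 h1 i j)
    exact (isOpen_ball.is_const_of_deriv_eq_zero (convex_ball w r).isPreconnected
      (fun y hy => (hd y hy).differentiableAt.differentiableWithinAt)
      (fun y hy => (hd y hy).deriv) hz (mem_ball_self hr))
  refine ⟨q w, hq0, ?_⟩
  filter_upwards [ball_mem_nhds w hr] with z hz
  have hzi := (hball z hz).2
  refine ⟨q z i / q w i, div_ne_zero hzi hi, ?_⟩
  funext j
  have := hconst z hz j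
  simp only [Pi.smul_apply, smul_eq_mul]
  field_simp at this ⊢
  linear_combination this

/-- A curve whose germs are all constant is constant. -/
lemma exists_eventually_eq_smul {ι : Type*} {P : ℂ → ι → ℂ}
    (h : ∀ w, ∃ v : ι → ℂ, v ≠ 0 ∧ ∀ᶠ z in 𝓝[≠] w, ∃ c : ℂ, c ≠ 0 ∧ P z = c • v) :
    ∃ v : ι → ℂ, v ≠ 0 ∧ ∀ w, ∀ᶠ z in 𝓝[≠] w, ∃ c : ℂ, c ≠ 0 ∧ P z = c • v := by
  obtain ⟨v, hv, h0⟩ := h 0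
  refine ⟨v, hv, eventually_nhdsNE_of_dichotomy (fun w => ?_) h0⟩
  obtain ⟨u, hu, hw⟩ := h w
  by_cases huv : ∃ d : ℂ, d ≠ 0 ∧ u = d • v
  · obtain ⟨d, hd, rfl⟩ := huv
    left
    filter_upwards [hw] with z ⟨c, hc, hz⟩
    exact ⟨c * d, mul_ne_zero hc hd, by rw [hz, smul_smul]⟩
  · right
    filter_upwards [hw] with z ⟨c, hc, hz⟩
    rintro ⟨d, hd, hz'⟩
    refine huv ⟨c⁻¹ * d, by simp [hc, hd], ?_⟩
    rw [← smul_smul, ← hz', hz, smul_smul, inv_mul_cancel₀ hc, one_smul]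

/-- Smooth plane curves of degree at least four are Brody hyperbolic. -/
theorem IsProjCurve.exists_eq_smul_of_isSmooth {f : MvPolynomial (Fin 3) ℂ} {m : ℕ} (hm : 4 ≤ m)
    (hf : f.IsHomogeneous m) (hs : IsSmooth f) {P : ℂ → Fin 3 → ℂ} (hP : IsProjCurve P)
    (hfP : ∀ w, eval (P w) f = 0) :
    ∃ v : Fin 3 → ℂ, v ≠ 0 ∧ ∀ w, ∀ᶠ z in 𝓝[≠] w, ∃ c : ℂ, c ≠ 0 ∧ P z = c • v := by
  obtain ⟨c, hc, hcf⟩ := hs.exists_le_nsq_grad hf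
  choose q hq hq0 hPq using hP
  have hfq : ∀ w, ∀ᶠ z in 𝓝 w, eval (q w z) f = 0 := by
    intro w
    refine ((hq w).eval_mvPolynomial' f).frequently_zero_iff_eventually_zero.1 ?_
    refine Eventually.frequently ?_
    filter_upwards [hPq w] with z ⟨c, hc, hz⟩
    rw [← hf.eval_smul_eq_zero_iff hc, ← hz, hfP]
  set h : ℂ → ℝ := fun z => canonicalMetric f m (q z z) (deriv (q z) z) with hh
  have hh' : ∀ w, ∀ᶠ z in 𝓝 w, h z = canonicalMetric f m (q w z) (deriv (q w) z) := by
    intro w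
    have h1 : ∀ᶠ z in 𝓝[≠] w, h z = canonicalMetric f m (q w z) (deriv (q w) z) := by
      filter_upwards [eventually_eventually_nhdsWithin.2 (hPq w), self_mem_nhdsWithin,
        nhdsWithin_le_nhds ((hq w).eventually_analyticAt),
        nhdsWithin_le_nhds ((hq w).continuousAt.eventually_ne (hq0 w))] with z hz hzw hz1 hz2
      rw [IsOpen.nhdsWithin_eq isOpen_compl_singleton hzw] at hz
      obtain ⟨l, hl, hl0, hzl⟩ := (hq z).exists_eventuallyEq_smul hz1 (hq0 z) hz2 (by
        filter_upwards [hPq z, nhdsWithin_le_nhds hz] with y ⟨c, hc, h1⟩ ⟨d, hd, h2⟩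
        exact ⟨c⁻¹ * d, by rw [← smul_smul, ← h2, h1, smul_smul, inv_mul_cancel₀ hc, one_smul]⟩)
      have hd : HasDerivAt (fun y => l y • q w y) (l z • deriv (q w) z + deriv l z • q w z) z :=
        hl.differentiableAt.hasDerivAt.smul hz1.differentiableAt.hasDerivAt
      have hd' : deriv (q z) z = _ := (EventuallyEq.deriv_eq hzl).trans hd.deriv
      simp only [hh]
      rw [hzl.self_of_nhds, hd', add_comm, canonicalMetric_smul (by omega) hf hl0]
    rw [eventually_nhdsWithin_iff] at h1
    filter_upwards [h1] with z hz
    by_cases hzw : z = w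
    · rw [hzw]
    · exact hz hzw
  have h0 : ∀ w, h w = 0 := by
    refine eq_zero_of_isNegativelyCurvedAt (ι := Fin 3) (c := 2 * c) (by positivity) (k := m - 3) (by omega)
      fun w => ?_
    obtain ⟨η, hη⟩ := hs.isNegativelyCurvedAt hm hf hcf (hq w) (hq0 w) (hfq w) (hh' w)
    exact ⟨η, _, hη⟩
  refine exists_eventually_eq_smul fun w => ?_
  obtain ⟨v, hv, hqv⟩ := exists_eventuallyEq_smul_of_wsq_eq_zero (hq w) (hq0 w) (by
    filter_upwards [hh' w, hfq w, (hq w).continuousAt.eventually_ne (hq0 w)] with z h1 h2 h3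
    rw [h0, canonicalMetric] at h1
    have h4 := nsq_pos h3
    have h5 : 0 < nsq (grad f (q w z)) := nsq_pos (hs.grad_ne_zero h3 h2)
    rcases mul_eq_zero.1 h1.symm with h6 | h6
    · rcases div_eq_zero_iff.1 h6 with h7 | h7
      · exact h7
      · linarith
    · exact absurd h6 (pow_pos h4 _).ne')
  refine ⟨v, hv, ?_⟩
  filter_upwards [hPq w, nhdsWithin_le_nhds hqv] with z ⟨c, hc, h1⟩ ⟨d, hd, h2⟩
  exact ⟨c * d, mul_ne_zero hc hd, by rw [h1, h2, smul_smul]⟩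

end

lemma exists_entire_pow_eq {u : ℂ → ℂ} (hu : Differentiable ℂ u) (h0 : ∀ w, u w ≠ 0)
    {n : ℕ} (hn : n ≠ 0) : ∃ k : ℂ → ℂ, Differentiable ℂ k ∧ ∀ w, k w ^ n = u w := by
  have hd : Differentiable ℂ (deriv u) := fun w => (hu.analyticAt w).deriv.differentiableAt
  obtain ⟨g, hg0, hg⟩ := (hd.div hu h0).isExactOn_univ.with_val_at 0 (Complex.log (u 0))
  have hg : ∀ w, HasDerivAt g (deriv u w / u w) w := fun w => hg w trivial
  have key : ∀ w, HasDerivAt (fun z => Complex.exp (g z) / u z) 0 w := by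
    intro w
    refine ((hg w).cexp.div (hu w).hasDerivAt (h0 w)).congr_deriv ?_
    have := h0 w
    field_simp
    ring
  have h1 : ∀ w, Complex.exp (g w) = u w := by
    intro w
    have := is_const_of_deriv_eq_zero (fun w => (key w).differentiableAt)
      (fun w => (key w).deriv) w 0
    simp only [hg0, Complex.exp_log (h0 0), div_self (h0 0)] at this
    exact (div_eq_one_iff_eq (h0 w)).1 this
  refine ⟨fun w => Complex.exp (g w / n), fun w => ?_, fun w => ?_⟩
  · exact ((hg w).differentiableAt.div_const _).cexp
  · rw [← Complex.exp_nat_mul, mul_div_cancel₀ _ (by exact_mod_cast hn), h1]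

/-- The Fermat quartic. -/
noncomputable def fermatQuartic : MvPolynomial (Fin 3) ℂ := ∑ i, X i ^ 4

lemma isHomogeneous_fermatQuartic : fermatQuartic.IsHomogeneous 4 :=
  IsHomogeneous.sum _ _ _ fun i _ => by simpa using (isHomogeneous_X ℂ i).pow 4

lemma isSmooth_fermatQuartic : IsSmooth fermatQuartic := by
  intro x hx _
  obtain ⟨i, hi⟩ := Function.ne_iff.1 hx
  refine ⟨i, ?_⟩
  have : pderiv i fermatQuartic = 4 * X i ^ 3 := by
    rw [fermatQuartic, map_sum, Finset.sum_eq_single i]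
    · simp
    · intro j _ hj
      simp [pderiv_X_of_ne hj]
    · simp
  rw [this]
  simpa using hi

/-- Three entire functions without zeros and with zero sum are proportional. -/
lemma eq_of_add_add_one_eq_zero {u v : ℂ → ℂ} (hu : Differentiable ℂ u) (hv : Differentiable ℂ v)
    (hu0 : ∀ w, u w ≠ 0) (hv0 : ∀ w, v w ≠ 0) (h : ∀ w, u w + v w + 1 = 0) (w w' : ℂ) :
    u w = u w' := by
  obtain ⟨k, hk, hku⟩ := exists_entire_pow_eq hu hu0 four_ne_zero
  obtain ⟨l, hl, hlv⟩ := exists_entire_pow_eq hv hv0 four_ne_zero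
  set P : ℂ → Fin 3 → ℂ := fun z => ![k z, l z, 1]
  have hP : IsProjCurve P := by
    refine fun w => ⟨P, ?_, ?_, Eventually.of_forall fun z => ⟨1, one_ne_zero, by simp⟩⟩
    · rw [analyticAt_pi_iff]
      intro i
      fin_cases i
      · exact hk.analyticAt w
      · exact hl.analyticAt w
      · exact analyticAt_const
    · exact fun h => one_ne_zero (congrFun h 2)
  obtain ⟨p, hp, hPp⟩ := hP.exists_eq_smul_of_isSmooth le_rfl isHomogeneous_fermatQuartic
    isSmooth_fermatQuartic (fun w => by
      simp [fermatQuartic, Fin.sum_univ_three, P, hku, hlv, h])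
  have key : ∀ w, u w = (p 0 / p 2) ^ 4 := by
    intro w
    have h1 : u =ᶠ[𝓝[≠] w] fun _ => (p 0 / p 2) ^ 4 := by
      filter_upwards [hPp w] with z ⟨c, hc, hz⟩
      have h0 : k z = c * p 0 := congrFun hz 0
      have h2 : 1 = c * p 2 := congrFun hz 2
      have hp2 : p 2 ≠ 0 := by rintro h; simp [h] at h2
      rw [← hku z, h0]
      congr 1
      field_simp
      linear_combination - p 0 * h2
    exact ((hu w).continuousAt.eventuallyEq_nhds_iff_eventuallyEq_nhdsNE
      continuousAt_const).1 h1 |>.self_of_nhds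
  rw [key w, key w']

/-- The projective classes of `ψ w` are given locally by a nonvanishing holomorphic map. -/
def IsHolCurve {ι : Type*} [Fintype ι] (ψ : ℂ → ι → ℂ) : Prop :=
  ∀ w, ∃ q : ℂ → ι → ℂ, AnalyticAt ℂ q w ∧ q w ≠ 0 ∧
    ∀ᶠ z in 𝓝 w, ∃ c : ℂ, c ≠ 0 ∧ ψ z = c • q z

section

variable {ι : Type*} [Fintype ι] {ψ : ℂ → ι → ℂ}

lemma IsHolCurve.isProjCurve (hψ : IsHolCurve ψ) : IsProjCurve ψ := fun w =>
  let ⟨q, h1, h2, h3⟩ := hψ w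
  ⟨q, h1, h2, nhdsWithin_le_nhds h3⟩

lemma IsHolCurve.eval_eq_zero (hψ : IsHolCurve ψ) {F : MvPolynomial ι ℂ} {n : ℕ}
    (hF : F.IsHomogeneous n) {a : ℂ} (ha : ∀ᶠ z in 𝓝[≠] a, eval (ψ z) F = 0) (w : ℂ) :
    eval (ψ w) F = 0 := by
  have h := hψ.isProjCurve.eventually_eval_eq_zero hF ha w
  obtain ⟨q, hq, -, hψq⟩ := hψ w
  have h1 : ∀ᶠ z in 𝓝 w, eval (q z) F = 0 := by
    refine (hq.eval_mvPolynomial' F).frequently_zero_iff_eventually_zero.1 (Eventually.frequently ?_)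
    filter_upwards [h, nhdsWithin_le_nhds hψq] with z hz ⟨c, hc, h2⟩
    rwa [h2, hF.eval_smul_eq_zero_iff hc] at hz
  obtain ⟨c, hc, h2⟩ := hψq.self_of_nhds
  rw [h2, hF.eval_smul_eq_zero_iff hc, h1.self_of_nhds]

/-- Either one form vanishes along the curve or the other does. -/
lemma IsHolCurve.eval_eq_zero_or (hψ : IsHolCurve ψ) {F G : MvPolynomial ι ℂ} {m n : ℕ}
    (hF : F.IsHomogeneous m) (hG : G.IsHomogeneous n)
    (h : ∀ w, eval (ψ w) F * eval (ψ w) G = 0) :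
    (∀ w, eval (ψ w) F = 0) ∨ ∀ w, eval (ψ w) G = 0 := by
  obtain ⟨q, hq, -, hψq⟩ := hψ 0
  rcases (hq.eval_mvPolynomial' F).eventually_eq_zero_or_eventually_ne_zero with h1 | h1
  · left
    refine hψ.eval_eq_zero hF (a := 0) (nhdsWithin_le_nhds ?_)
    filter_upwards [h1, hψq] with z h0 ⟨c, hc, hz⟩
    rw [hz, hF.eval_smul_eq_zero_iff hc, h0]
  · right
    refine hψ.eval_eq_zero hG (a := 0) ?_
    filter_upwards [h1, nhdsWithin_le_nhds hψq] with z h0 ⟨c, hc, hz⟩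
    refine (mul_eq_zero.1 (h z)).resolve_left ?_
    rwa [hz, hF.eval_smul_eq_zero_iff hc]

lemma IsHolCurve.differentiable_div (hψ : IsHolCurve ψ) (L M : (ι → ℂ) →L[ℂ] ℂ)
    (hM : ∀ w, M (ψ w) ≠ 0) : Differentiable ℂ fun w => L (ψ w) / M (ψ w) := by
  intro w
  obtain ⟨q, hq, hq0, hψq⟩ := hψ w
  have h1 : (fun w => L (ψ w) / M (ψ w)) =ᶠ[𝓝 w] fun w => L (q w) / M (q w) := by
    filter_upwards [hψq] with z ⟨c, hc, hz⟩
    rw [hz, map_smul, map_smul, smul_eq_mul, smul_eq_mul, mul_div_mul_left _ _ hc]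
  have h2 : M (q w) ≠ 0 := by
    obtain ⟨c, hc, hz⟩ := hψq.self_of_nhds
    have := hM w
    rw [hz, map_smul] at this
    exact right_ne_zero_of_mul this
  refine DifferentiableAt.congr_of_eventuallyEq ?_ h1
  exact ((L.differentiableAt.comp w hq.differentiableAt).div
    (M.differentiableAt.comp w hq.differentiableAt) h2)

end

/-- A holomorphic curve in a cone over a hyperbolic plane curve lies in a ruling. -/
lemma IsHolCurve.exists_ruling {ψ : ℂ → Fin 4 → ℂ} (hψ : IsHolCurve ψ)
    {f : MvPolynomial (Fin 3) ℂ} {m : ℕ} (hm : 4 ≤ m) (hf : f.IsHomogeneous m) (hs : IsSmooth f)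
    (h : ∀ w, eval ![ψ w 0, ψ w 1, ψ w 2] f = 0)
    (hne : ∃ w, ∃ i : Fin 3, ψ w i.castSucc ≠ 0) :
    ∃ p : Fin 3 → ℂ, p ≠ 0 ∧ eval p f = 0 ∧
      ∀ w, ∃ c : ℂ, ∀ i : Fin 3, ψ w i.castSucc = c * p i := by
  set P : ℂ → Fin 3 → ℂ := fun w i => ψ w i.castSucc with hPdef
  have hfP : ∀ w, eval (P w) f = 0 := by
    intro w
    rw [← h w]
    congr 2
    funext i
    fin_cases i <;> rfl
  have hP : IsProjCurve P := by
    intro w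
    obtain ⟨q, hq, hq0, hψq⟩ := hψ w
    set r : ℂ → Fin 3 → ℂ := fun z i => q z i.castSucc with hr
    have hra : AnalyticAt ℂ r w := analyticAt_pi_iff.2 fun i => analyticAt_pi_iff.1 hq i.castSucc
    have hr0 : ¬ ∀ᶠ z in 𝓝 w, r z = 0 := by
      intro h0
      obtain ⟨a, i, ha⟩ := hne
      refine ha ?_
      have := hψ.eval_eq_zero (isHomogeneous_X ℂ i.castSucc) (a := w) (nhdsWithin_le_nhds (by
        filter_upwards [h0, hψq] with z hz ⟨c, hc, h1⟩
        have : q z i.castSucc = 0 := congrFun hz i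
        simp [h1, this])) a
      simpa using this
    obtain ⟨n, g, hg, hg0, hrg⟩ := hra.exists_eventuallyEq_pow_smul_nonzero_iff.2 hr0
    refine ⟨g, hg, hg0, ?_⟩
    filter_upwards [nhdsWithin_le_nhds hrg, nhdsWithin_le_nhds hψq, self_mem_nhdsWithin]
      with z h1 ⟨c, hc, h2⟩ hzw
    refine ⟨c * (z - w) ^ n, mul_ne_zero hc (pow_ne_zero _ (sub_ne_zero.2 hzw)), ?_⟩
    rw [← smul_smul, ← h1]
    funext i
    simp [hPdef, h2, hr]
  obtain ⟨p, hp, hPp⟩ := hP.exists_eq_smul_of_isSmooth hm hf hs hfP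
  refine ⟨p, hp, ?_, fun w => ?_⟩
  · obtain ⟨z, c, hc, hz⟩ := (hPp 0).exists
    rw [← hf.eval_smul_eq_zero_iff hc, ← hz, hfP]
  · have hpar : ∀ i j : Fin 3, ψ w i.castSucc * p j = ψ w j.castSucc * p i := by
      intro i j
      have := hψ.eval_eq_zero (F := C (p j) * X i.castSucc - C (p i) * X j.castSucc) (n := 0 + 1)
        (((isHomogeneous_C _ _).mul (isHomogeneous_X _ _)).sub
          ((isHomogeneous_C _ _).mul (isHomogeneous_X _ _))) (a := 0) (by
          filter_upwards [hPp 0] with z ⟨c, hc, hz⟩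
          have hi : ψ z i.castSucc = c * p i := congrFun hz i
          have hj : ψ z j.castSucc = c * p j := congrFun hz j
          simp only [map_sub, map_mul, eval_C, eval_X, hi, hj]
          ring) w
      simp only [map_sub, map_mul, eval_C, eval_X] at this
      linear_combination this
    obtain ⟨j, hj⟩ := Function.ne_iff.1 hp
    have hj : p j ≠ 0 := hj
    refine ⟨ψ w j.castSucc / p j, fun i => ?_⟩
    have := hpar i j
    field_simp
    exact this

lemma det_ne_zero_of_linearIndependent_pair {V : Type*} [AddCommGroup V] [Module ℂ V] {x y : V}
    {a b c d : ℂ} (h : LinearIndependent ℂ ![a • x + b • y, c • x + d • y]) :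
    a * d - c * b ≠ 0 := by
  intro h0
  rw [LinearIndependent.pair_iff] at h
  obtain ⟨h1, h2⟩ := h c (-a) (by
    have : c • (a • x + b • y) + -a • (c • x + d • y) = -((a * d - c * b) • y) := by module
    rw [this, h0, zero_smul, neg_zero])
  obtain ⟨h3, h4⟩ := h d (-b) (by
    have : d • (a • x + b • y) + -b • (c • x + d • y) = (a * d - c * b) • x := by module
    rw [this, h0, zero_smul])
  rw [neg_eq_zero] at h2 h4
  have := h 1 0 (by simp [h1, h2, h3, h4])
  exact one_ne_zero this.1

/-- A function satisfying a homogeneous equation that is monic in it is bounded. -/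
lemma exists_norm_le_of_eval_eq_zero {f : MvPolynomial (Fin 3) ℂ} {n : ℕ} (hf : f.IsHomogeneous n)
    (hv : eval ![0, 0, 1] f ≠ 0) (x y : ℂ) :
    ∃ C : ℝ, ∀ r : ℂ, eval ![x, y, r] f = 0 → ‖r‖ ≤ C := by
  have hc : Continuous fun s : ℂ => eval ![x * s, y * s, 1] f :=
    (MvPolynomial.continuous_eval f).comp (by
      refine continuous_pi fun i => ?_
      fin_cases i <;> simp <;> fun_prop)
  have h0 : ∀ᶠ s in 𝓝 (0 : ℂ), eval ![x * s, y * s, 1] f ≠ 0 :=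
    hc.continuousAt.eventually_ne (by simpa using hv)
  obtain ⟨δ, hδ, hball⟩ := eventually_nhds_iff_ball.1 h0
  refine ⟨δ⁻¹, fun r hr => ?_⟩
  by_contra! hlt
  have hr0 : r ≠ 0 := by
    rintro rfl
    simp only [norm_zero] at hlt
    exact absurd hlt (not_lt.2 (by positivity))
  refine hball r⁻¹ ?_ ?_
  · rw [mem_ball_zero_iff, norm_inv]
    exact inv_lt_of_inv_lt₀ hδ hlt
  · rw [← hf.eval_smul_eq_zero_iff hr0, ← hr]
    congr 2
    funext i
    fin_cases i <;> simp <;> field_simp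

lemma eval_rename_zero_one_three (v : Fin 4 → ℂ) (f : MvPolynomial (Fin 3) ℂ) :
    eval v (rename ![0, 1, 3] f) = eval ![v 0, v 1, v 3] f := by
  rw [eval_rename]
  congr 2
  funext i
  fin_cases i <;> rfl

/-- There is no nonconstant holomorphic curve in a cone, all of whose intersections with a second
cone are excluded near at least three points of every ruling. -/
theorem IsHolCurve.false_of_cone {m n : ℕ} (hm : 4 ≤ m) {f₁ f₂ : MvPolynomial (Fin 3) ℂ}
    (hf₁ : f₁.IsHomogeneous m) (hs : IsSmooth f₁) (hf₂ : f₂.IsHomogeneous n)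
    (hv₂ : eval ![0, 0, 1] f₂ ≠ 0) {N : (Fin 4 → ℂ) → Prop}
    (hN : ∀ c : ℂ, c ≠ 0 → ∀ v, N v → N (c • v))
    (hruling : ∀ p : Fin 3 → ℂ, p ≠ 0 → eval p f₁ = 0 →
      ∃ v₁ v₂ v₃ : Fin 4 → ℂ, LinearIndependent ℂ ![v₁, v₂] ∧ LinearIndependent ℂ ![v₁, v₃] ∧
        LinearIndependent ℂ ![v₂, v₃] ∧ (∀ v ∈ ({v₁, v₂, v₃} : Set (Fin 4 → ℂ)),
          v ∈ Submodule.span ℂ {![p 0, p 1, p 2, 0], ![0, 0, 0, 1]} ∧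
            eval ![v 0, v 1, v 3] f₂ = 0 ∧ N v))
    {ψ : ℂ → Fin 4 → ℂ} (hψ : IsHolCurve ψ) (hψ0 : ∀ w, ψ w ≠ 0)
    (hψ₁ : ∀ w, eval ![ψ w 0, ψ w 1, ψ w 2] f₁ = 0)
    (hψN : ∀ w, N (ψ w) → eval ![ψ w 0, ψ w 1, ψ w 3] f₂ = 0 →
      ∀ᶠ z in 𝓝 w, eval ![ψ z 0, ψ z 1, ψ z 3] f₂ = 0)
    {w w' : ℂ} {i j : Fin 4} (hne : ψ w i * ψ w' j ≠ ψ w j * ψ w' i) : False := by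
  have hF := fun v => eval_rename_zero_one_three v f₂
  have hFh : (rename ![0, 1, 3] f₂ : MvPolynomial (Fin 4) ℂ).IsHomogeneous n :=
    hf₂.rename_isHomogeneous
  obtain ⟨p, hp, hfp, hruled⟩ := hψ.exists_ruling hm hf₁ hs hψ₁ (by
    by_contra! h0
    have h3 : ∀ w, ∀ i : Fin 4, i ≠ 3 → ψ w i = 0 := by
      intro w i hi
      fin_cases i
      · exact h0 w 0
      · exact h0 w 1
      · exact h0 w 2
      · exact absurd rfl hi
    refine hne ?_
    by_cases hi : i = 3 <;> by_cases hj : j = 3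
    · rw [hi, hj]
    · rw [h3 w j hj, h3 w' j hj]; ring
    · rw [h3 w i hi, h3 w' i hi]; ring
    · rw [h3 w i hi, h3 w' i hi]; ring)
  choose α hα using hruled
  set x : Fin 4 → ℂ := ![p 0, p 1, p 2, 0] with hx
  set e : Fin 4 → ℂ := ![0, 0, 0, 1] with he
  have hψα : ∀ w, ψ w = α w • x + ψ w 3 • e := by
    intro w
    funext i
    fin_cases i
    · simpa [hx, he] using hα w 0
    · simpa [hx, he] using hα w 1
    · simpa [hx, he] using hα w 2
    · simp [hx, he]
  have hne' : α w * ψ w' 3 ≠ α w' * ψ w 3 := by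
    intro h
    refine hne ?_
    have key : ∀ i j, ψ w i * ψ w' j - ψ w j * ψ w' i =
        (α w * ψ w' 3 - α w' * ψ w 3) * (x i * e j - x j * e i) := by
      intro i j
      have h1 := congrFun (hψα w) i
      have h2 := congrFun (hψα w) j
      have h3 := congrFun (hψα w') i
      have h4 := congrFun (hψα w') j
      simp only [Pi.add_apply, Pi.smul_apply, smul_eq_mul] at h1 h2 h3 h4
      rw [h1, h2, h3, h4]
      ring
    rw [← sub_eq_zero, key, h, sub_self, zero_mul]
  obtain ⟨k, hk⟩ := Function.ne_iff.1 hp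
  have hk : p k ≠ 0 := hk
  have hαk : ∀ w, ψ w k.castSucc = α w * p k := fun w => hα w k
  -- the curve is not contained in the second cone
  have hnot : ∀ w, ¬ ∀ᶠ z in 𝓝 w, eval ![ψ z 0, ψ z 1, ψ z 3] f₂ = 0 := by
    intro b hb
    have hall : ∀ w, eval ![ψ w 0, ψ w 1, ψ w 3] f₂ = 0 := fun w => by
      rw [← hF]
      exact hψ.eval_eq_zero hFh (a := b) ((hb.filter_mono nhdsWithin_le_nhds).mono fun z hz => by
        rwa [hF]) w
    have hα0 : ∀ w, α w ≠ 0 := by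
      intro w h0
      have h1 := hall w
      have h2 : (![ψ w 0, ψ w 1, ψ w 3] : Fin 3 → ℂ) = ψ w 3 • ![0, 0, 1] := by
        have a0 := hα w 0
        have a1 := hα w 1
        simp only [h0, zero_mul] at a0 a1
        funext i
        fin_cases i
        · simpa using a0
        · simpa using a1
        · simp
      have h3 : ψ w 3 ≠ 0 := by
        intro h3
        apply hψ0 w
        rw [hψα w, h0, h3]; simp
      rw [h2, hf₂.eval_smul_eq_zero_iff h3] at h1
      exact hv₂ h1
    obtain ⟨B, hB⟩ := exists_norm_le_of_eval_eq_zero hf₂ hv₂ (p 0) (p 1)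
    have hd := hψ.differentiable_div (p k • ContinuousLinearMap.proj 3)
      (ContinuousLinearMap.proj k.castSucc) (fun w => by
        simp only [ContinuousLinearMap.proj_apply, hαk]
        exact mul_ne_zero (hα0 w) hk)
    have heq : ∀ w, (p k • ContinuousLinearMap.proj 3 : (Fin 4 → ℂ) →L[ℂ] ℂ) (ψ w) /
        (ContinuousLinearMap.proj k.castSucc : (Fin 4 → ℂ) →L[ℂ] ℂ) (ψ w) = ψ w 3 / α w := by
      intro w
      have := hα0 w
      simp only [ContinuousLinearMap.proj_apply, smul_apply, smul_eq_mul, hαk]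
      field_simp
    simp only [heq] at hd
    have hbd : Bornology.IsBounded (Set.range fun w => ψ w 3 / α w) := by
      rw [isBounded_iff_forall_norm_le]
      refine ⟨B, ?_⟩
      rintro _ ⟨w, rfl⟩
      refine hB _ ?_
      rw [← hf₂.eval_smul_eq_zero_iff (hα0 w), ← hall w]
      congr 2
      have := hα0 w
      funext i
      fin_cases i
      · simpa using (hα w 0).symm
      · simpa using (hα w 1).symm
      · simp; field_simp
    have : ψ w 3 / α w = ψ w' 3 / α w' := hd.apply_eq_apply_of_bounded hbd w w'
    have h1 := hα0 w
    have h2 := hα0 w'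
    field_simp at this
    exact hne' (by linear_combination -this)
  obtain ⟨v₁, v₂, v₃, h12, h13, h23, hv⟩ := hruling p hp hfp
  obtain ⟨hs₁, hz₁, hN₁⟩ := hv v₁ (by simp)
  obtain ⟨hs₂, hz₂, hN₂⟩ := hv v₂ (by simp)
  obtain ⟨hs₃, hz₃, hN₃⟩ := hv v₃ (by simp)
  obtain ⟨a₁, b₁, rfl⟩ := Submodule.mem_span_pair.1 hs₁
  obtain ⟨a₂, b₂, rfl⟩ := Submodule.mem_span_pair.1 hs₂
  obtain ⟨a₃, b₃, rfl⟩ := Submodule.mem_span_pair.1 hs₃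
  have c12 := det_ne_zero_of_linearIndependent_pair h12
  have c13 := det_ne_zero_of_linearIndependent_pair h13
  have c23 := det_ne_zero_of_linearIndependent_pair h23
  -- the curve omits the three given points of its ruling
  have homit : ∀ a b : ℂ, (a ≠ 0 ∨ b ≠ 0) →
      eval ![(a • x + b • e) 0, (a • x + b • e) 1, (a • x + b • e) 3] f₂ = 0 →
      N (a • x + b • e) → ∀ w, α w * b - ψ w 3 * a ≠ 0 := by
    intro a b hab hz hNv w h0
    obtain ⟨c, hc⟩ : ∃ c : ℂ, ψ w = c • (a • x + b • e) := by
      rcases hab with ha | hb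
      · refine ⟨α w / a, ?_⟩
        have : ψ w 3 = α w / a * b := by field_simp; linear_combination -h0
        refine (hψα w).trans ?_
        rw [this, smul_add, smul_smul, smul_smul, div_mul_cancel₀ _ ha]
      · refine ⟨ψ w 3 / b, ?_⟩
        have : α w = ψ w 3 / b * a := by field_simp; linear_combination h0
        refine (hψα w).trans ?_
        rw [this, smul_add, smul_smul, smul_smul, div_mul_cancel₀ _ hb]
    have hc0 : c ≠ 0 := by
      rintro rfl
      exact hψ0 w (by rw [hc, zero_smul])
    refine hnot w (hψN w (hc ▸ hN c hc0 _ hNv) ?_)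
    rwa [← hF, hc, hFh.eval_smul_eq_zero_iff hc0, hF]
  have n₁ := homit a₁ b₁ (by by_contra! h; simp [h.1, h.2] at c12) hz₁ hN₁
  have n₂ := homit a₂ b₂ (by by_contra! h; simp [h.1, h.2] at c12) hz₂ hN₂
  have n₃ := homit a₃ b₃ (by by_contra! h; simp [h.1, h.2] at c13) hz₃ hN₃
  set L : ℂ → ℂ → (Fin 4 → ℂ) →L[ℂ] ℂ := fun a b =>
    b • ContinuousLinearMap.proj k.castSucc - (a * p k) • ContinuousLinearMap.proj 3 with hL
  have hLψ : ∀ a b w, L a b (ψ w) = p k * (α w * b - ψ w 3 * a) := by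
    intro a b w
    simp only [hL, sub_apply, smul_apply,
      ContinuousLinearMap.proj_apply, smul_eq_mul, hαk]
    ring
  have hL3 : ∀ w, L a₃ b₃ (ψ w) ≠ 0 := fun w => by
    rw [hLψ]; exact mul_ne_zero hk (n₃ w)
  have hdiff : ∀ a b, Differentiable ℂ fun w =>
      (α w * b - ψ w 3 * a) / (α w * b₃ - ψ w 3 * a₃) := by
    intro a b
    have := hψ.differentiable_div (L a b) (L a₃ b₃) hL3
    simpa only [hLψ, mul_div_mul_left _ _ hk] using this
  have hconst := eq_of_add_add_one_eq_zero
    (u := fun w => (a₂ * b₃ - a₃ * b₂) / (a₁ * b₂ - a₂ * b₁) *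
      ((α w * b₁ - ψ w 3 * a₁) / (α w * b₃ - ψ w 3 * a₃)))
    (v := fun w => -(a₁ * b₃ - a₃ * b₁) / (a₁ * b₂ - a₂ * b₁) *
      ((α w * b₂ - ψ w 3 * a₂) / (α w * b₃ - ψ w 3 * a₃)))
    ((hdiff a₁ b₁).const_mul _) ((hdiff a₂ b₂).const_mul _)
    (fun w => mul_ne_zero (div_ne_zero c23 c12) (div_ne_zero (n₁ w) (n₃ w)))
    (fun w => mul_ne_zero (div_ne_zero (neg_ne_zero.2 c13) c12) (div_ne_zero (n₂ w) (n₃ w)))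
    (fun w => by
      rw [div_mul_div_comm, div_mul_div_comm, ← add_div, div_add_one (mul_ne_zero c12 (n₃ w)),
        div_eq_zero_iff]
      left
      ring) w w'
  have h5 := mul_left_cancel₀ (div_ne_zero c23 c12) hconst
  have h6 := n₃ w
  have h7 := n₃ w'
  rw [div_eq_div_iff h6 h7] at h5
  refine hne' (mul_left_cancel₀ c13 ?_)
  linear_combination h5

section

variable {ι : Type*} [Fintype ι]

lemma norm_sq_cross_le_wsq (p q : ι → ℂ) (i j : ι) : ‖p i * q j - p j * q i‖ ^ 2 ≤ wsq p q := by
  refine le_trans ?_ (Finset.single_le_sum (f := fun i => ∑ j, ‖p i * q j - p j * q i‖ ^ 2)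
    (fun _ _ => Finset.sum_nonneg fun _ _ => by positivity) (Finset.mem_univ i))
  exact Finset.single_le_sum (f := fun j => ‖p i * q j - p j * q i‖ ^ 2)
    (fun _ _ => by positivity) (Finset.mem_univ j)

lemma norm_mul_norm_le_nsq (p : ι → ℂ) (i j : ι) : ‖p i‖ * ‖p j‖ ≤ nsq p := by
  nlinarith [norm_sq_le_nsq p i, norm_sq_le_nsq p j, sq_nonneg (‖p i‖ - ‖p j‖)]

lemma exists_hasDerivAt_norm_sq_div_nsq {l : ℝ → ι → ℂ} {l' : ι → ℂ} {s : ℝ}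
    (hl : HasDerivAt l l' s) (h0 : l s ≠ 0) (i : ι) :
    ∃ d : ℝ, HasDerivAt (fun s => ‖l s i‖ ^ 2 / nsq (l s)) d s ∧
      ‖d‖ * nsq (l s) ≤ 2 * Fintype.card ι * √(wsq (l s) l') := by
  have hli := hasDerivAt_pi.1 hl
  have hN := nsq_pos h0
  have h1 : ∀ j, HasDerivAt (fun s => ‖l s j‖ ^ 2) (2 * inner ℝ (l s j) (l' j)) s :=
    fun j => (hli j).norm_sq
  have h2 : HasDerivAt (fun s => nsq (l s)) (∑ j, 2 * inner ℝ (l s j) (l' j)) s :=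
    HasDerivAt.fun_sum fun j _ => h1 j
  refine ⟨_, (h1 i).div h2 hN.ne', ?_⟩
  have key : 2 * inner ℝ (l s i) (l' i) * nsq (l s) -
      ‖l s i‖ ^ 2 * ∑ j, 2 * inner ℝ (l s j) (l' j) =
      ∑ j, -2 * (starRingEnd ℂ (l s i) * starRingEnd ℂ (l s j) *
        (l s i * l' j - l s j * l' i)).re := by
    rw [nsq, Finset.mul_sum, Finset.mul_sum, ← Finset.sum_sub_distrib]
    refine Finset.sum_congr rfl fun j _ => ?_
    simp only [Complex.inner, Complex.sq_norm, Complex.normSq_apply, Complex.mul_re, Complex.mul_im,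
      Complex.conj_re, Complex.conj_im, Complex.sub_re, Complex.sub_im]
    ring
  have hbound : ‖2 * inner ℝ (l s i) (l' i) * nsq (l s) -
      ‖l s i‖ ^ 2 * ∑ j, 2 * inner ℝ (l s j) (l' j)‖ ≤
      Fintype.card ι * (2 * (nsq (l s) * √(wsq (l s) l'))) := by
    rw [key]
    refine (norm_sum_le _ _).trans ?_
    rw [← nsmul_eq_mul, Fintype.card]
    refine Finset.sum_le_card_nsmul _ _ _ fun j _ => ?_
    rw [norm_mul, norm_neg, Real.norm_ofNat]
    gcongr
    rw [Real.norm_eq_abs]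
    refine (Complex.abs_re_le_norm _).trans ?_
    rw [norm_mul, norm_mul, RCLike.norm_conj, RCLike.norm_conj]
    gcongr
    · exact norm_mul_norm_le_nsq _ _ _
    · exact Real.le_sqrt_of_sq_le (norm_sq_cross_le_wsq _ _ _ _)
  rw [norm_div, norm_pow, Real.norm_of_nonneg hN.le, div_mul_eq_mul_div,
    div_le_iff₀ (by positivity)]
  nlinarith [hbound]

/-- A bound on the Fubini-Study derivative controls the variation of `|qᵢ|² / |q|²`. -/
lemma norm_sq_div_nsq_sub_le {q : ℂ → ι → ℂ} (hq : Differentiable ℂ q) (hq0 : ∀ w, q w ≠ 0)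
    {w₀ w : ℂ} {r K : ℝ} (hK : 0 ≤ K)
    (hD : ∀ z ∈ ball w₀ r, wsq (q z) (deriv q z) ≤ K ^ 2 * nsq (q z) ^ 2) (hw : w ∈ ball w₀ r)
    (i : ι) :
    ‖‖q w i‖ ^ 2 / nsq (q w) - ‖q w₀ i‖ ^ 2 / nsq (q w₀)‖ ≤
      2 * Fintype.card ι * (K * ‖w - w₀‖) := by
  set l : ℝ → ι → ℂ := fun s => q (w₀ + s * (w - w₀)) with hl
  have hlin : ∀ s : ℝ, HasDerivAt (fun s : ℝ => w₀ + s * (w - w₀)) (w - w₀) s := by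
    intro s
    simpa using ((Complex.ofRealCLM.hasDerivAt (x := s)).mul_const (w - w₀)).const_add w₀
  have hd : ∀ s : ℝ, HasDerivAt l ((w - w₀) • deriv q (w₀ + s * (w - w₀))) s := fun s =>
    (hq _).hasDerivAt.scomp s (hlin s)
  choose d hd1 hd2 using fun s => exists_hasDerivAt_norm_sq_div_nsq (hd s) (hq0 _) i
  have := norm_image_sub_le_of_norm_deriv_le_segment_01'
    (f := fun s => ‖l s i‖ ^ 2 / nsq (l s)) (f' := d)
    (C := 2 * Fintype.card ι * (K * ‖w - w₀‖)) (fun s _ => (hd1 s).hasDerivWithinAt) (by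
      intro s hs
      have hN := nsq_pos (hq0 (w₀ + s * (w - w₀)))
      have hmem : w₀ + s * (w - w₀) ∈ ball w₀ r := by
        rw [mem_ball_iff_norm] at hw ⊢
        rw [add_sub_cancel_left, norm_mul, Complex.norm_real, Real.norm_of_nonneg hs.1]
        nlinarith [hs.1, hs.2, norm_nonneg (w - w₀)]
      have h1 : wsq (l s) ((w - w₀) • deriv q (w₀ + s * (w - w₀))) ≤
          (K * ‖w - w₀‖ * nsq (l s)) ^ 2 := by
        have h2 : wsq (l s) ((w - w₀) • deriv q (w₀ + s * (w - w₀))) =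
            ‖w - w₀‖ ^ 2 * wsq (l s) (deriv q (w₀ + s * (w - w₀))) := by
          simp only [wsq, Finset.mul_sum, ← mul_pow, ← norm_mul, Pi.smul_apply, smul_eq_mul]
          refine Finset.sum_congr rfl fun i _ => Finset.sum_congr rfl fun j _ => ?_
          congr 2
          ring
        rw [h2]
        have := mul_le_mul_of_nonneg_left (hD _ hmem) (sq_nonneg ‖w - w₀‖)
        calc _ ≤ _ := this
          _ = _ := by simp only [hl]; ring
      have h3 := Real.sqrt_le_sqrt h1
      rw [Real.sqrt_sq (by positivity)] at h3
      have h4 := hd2 s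
      refine le_of_mul_le_mul_right (h4.trans ?_) hN
      calc _ ≤ 2 * Fintype.card ι * (K * ‖w - w₀‖ * nsq (l s)) := by gcongr
        _ = _ := by simp only [hl]; ring)
  simpa [hl] using this

end

/-- A bounded sequence of holomorphic maps converging pointwise along a filter converges locally
uniformly. -/
lemma tendstoLocallyUniformlyOn_of_bounded {E κ : Type*} [NormedAddCommGroup E] [NormedSpace ℂ E]
    [CompleteSpace E] {l : Filter κ} [l.NeBot] {F : κ → ℂ → E} {f : ℂ → E} {w₀ : ℂ} {ρ M : ℝ}
    (hF : ∀ᶠ n in l, DifferentiableOn ℂ (F n) (ball w₀ (2 * ρ)))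
    (hM : ∀ᶠ n in l, ∀ z ∈ ball w₀ (2 * ρ), ‖F n z‖ ≤ M)
    (hf : ∀ z ∈ ball w₀ ρ, Tendsto (fun n => F n z) l (𝓝 (f z))) :
    TendstoLocallyUniformlyOn F f l (ball w₀ ρ) := by
  rcases le_or_gt ρ 0 with hρ | hρ
  · rw [ball_eq_empty.2 hρ]
    intro u _ x hx
    simp at hx
  have hsub : ball w₀ ρ ⊆ ball w₀ (2 * ρ) := ball_subset_ball (by linarith)
  have hL : ∀ᶠ n in l, ∀ x ∈ ball w₀ ρ, ∀ y ∈ ball w₀ ρ,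
      ‖F n y - F n x‖ ≤ M / (ρ / 2) * ‖y - x‖ := by
    filter_upwards [hF, hM] with n h1 h2 x hx y hy
    refine Convex.norm_image_sub_le_of_norm_deriv_le (𝕜 := ℂ) (s := ball w₀ ρ) (fun z hz =>
      h1.differentiableAt (isOpen_ball.mem_nhds (hsub hz))) (fun z hz => ?_) (convex_ball _ _) hx hy
    have hcl : closedBall z (ρ / 2) ⊆ ball w₀ (2 * ρ) := by
      refine closedBall_subset_ball' ?_
      rw [mem_ball] at hz
      linarith
    exact Complex.norm_deriv_le_of_forall_mem_sphere_norm_le (by positivity)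
      ((h1.mono (by rw [closure_ball _ (by positivity)]; exact hcl)).diffContOnCl)
      fun y hy => h2 y (hcl (sphere_subset_closedBall hy))
  have hLf : ∀ x ∈ ball w₀ ρ, ∀ y ∈ ball w₀ ρ, ‖f y - f x‖ ≤ M / (ρ / 2) * ‖y - x‖ :=
    fun x hx y hy => le_of_tendsto ((hf y hy).sub (hf x hx)).norm
      (hL.mono fun n hn => hn x hx y hy)
  rw [Metric.tendstoLocallyUniformlyOn_iff]
  intro ε hε x hx
  set C := |M / (ρ / 2)| + 1
  have hC : 0 < C := by positivity
  have hMC : M / (ρ / 2) ≤ C := (le_abs_self _).trans (by simp [C])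
  refine ⟨ball x (ε / 3 / C) ∩ ball w₀ ρ, inter_mem (mem_nhdsWithin_of_mem_nhds
    (ball_mem_nhds _ (by positivity))) self_mem_nhdsWithin, ?_⟩
  filter_upwards [hL, (Metric.tendsto_nhds.1 (hf x hx)) (ε / 3) (by positivity)]
    with n h1 h2 y ⟨hy1, hy2⟩
  have h3 : M / (ρ / 2) * ‖y - x‖ ≤ ε / 3 := by
    rw [mem_ball_iff_norm] at hy1
    calc _ ≤ C * ‖y - x‖ := by gcongr
      _ ≤ C * (ε / 3 / C) := by gcongr
      _ = ε / 3 := by field_simp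
  have h4 := (h1 x hx y hy2).trans h3
  have h5 := (hLf x hx y hy2).trans h3
  rw [← dist_eq_norm] at h4 h5
  have := dist_triangle4 (f y) (f x) (F n x) (F n y)
  rw [dist_comm (f x), dist_comm (F n x) (F n y)] at this
  linarith

section

/-- The projective classes of `g n` converge to that of `ψ` along `l`, locally in a common affine
chart in which they are uniformly bounded. -/
def IsChartLimit {ι κ : Type*} [Fintype ι] (g : κ → ℂ → ι → ℂ) (l : Filter κ) (ψ : ℂ → ι → ℂ) :
    Prop :=
  ∀ w, ∃ i, ∃ ρ > 0, ∃ M : ℝ,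
    (∀ᶠ n in l, ∀ z ∈ ball w (2 * ρ), g n z i ≠ 0 ∧ ‖(g n z i)⁻¹ • g n z‖ ≤ M) ∧
    ∀ z ∈ ball w ρ, ψ z i ≠ 0 ∧
      Tendsto (fun n => (g n z i)⁻¹ • g n z) l (𝓝 ((ψ z i)⁻¹ • ψ z))

variable {ι : Type*} [Fintype ι]

lemma norm_sq_smul_div_nsq_smul {c : ℂ} (hc : c ≠ 0) (p : ι → ℂ) (i : ι) :
    ‖(c • p) i‖ ^ 2 / nsq (c • p) = ‖p i‖ ^ 2 / nsq p := by
  have : ‖c‖ ≠ 0 := by simpa using hc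
  rw [nsq_smul, Pi.smul_apply, smul_eq_mul, norm_mul, mul_pow, mul_div_mul_left _ _ (by positivity)]

/-- Normality of sequences of entire curves with bounded Fubini-Study derivative. -/
theorem exists_isChartLimit {g : ℕ → ℂ → ι → ℂ} (hg : ∀ n, Differentiable ℂ (g n))
    (hg0 : ∀ n w, g n w ≠ 0) {K : ℝ} (hK : 0 ≤ K)
    (hD : ∀ n : ℕ, ∀ w ∈ ball (0 : ℂ) n,
      wsq (g n w) (deriv (g n) w) ≤ K ^ 2 * nsq (g n w) ^ 2) :
    ∃ ψ : ℂ → ι → ℂ, IsChartLimit g (hyperfilter ℕ : Filter ℕ) ψ := by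
  set U : Ultrafilter ℕ := hyperfilter ℕ
  set c : ℕ → ℂ → ℂ := fun n w => ((‖g n w‖⁻¹ : ℝ) : ℂ) with hcdef
  have hc : ∀ n w, c n w ≠ 0 := fun n w => by
    simpa [hcdef] using hg0 n w
  have hlim : ∀ w, ∃ p : ι → ℂ, p ≠ 0 ∧ Tendsto (fun n => c n w • g n w) U (𝓝 p) := by
    intro w
    obtain ⟨p, hp, hle⟩ := (isCompact_sphere (0 : ι → ℂ) 1).ultrafilter_le_nhds
      (U.map fun n => c n w • g n w) (by
        rw [le_principal_iff]
        refine Eventually.of_forall (f := (U : Filter ℕ)) fun n => ?_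
        have : ‖g n w‖ ≠ 0 := by simpa using hg0 n w
        simp [hcdef, norm_smul, this])
    refine ⟨p, ?_, hle⟩
    rintro rfl
    simp at hp
  choose ψ hψ0 hψ using hlim
  have hθ : ∀ w i, Tendsto (fun n => ‖g n w i‖ ^ 2 / nsq (g n w)) U
      (𝓝 (‖ψ w i‖ ^ 2 / nsq (ψ w))) := by
    intro w i
    have h1 := ((((continuous_apply i).tendsto _).comp (hψ w)).norm.pow 2).div
      ((continuous_nsq.tendsto _).comp (hψ w)) (nsq_pos (hψ0 w)).ne'
    refine h1.congr fun n => ?_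
    exact norm_sq_smul_div_nsq_smul (hc n w) _ _
  refine ⟨ψ, fun w => ?_⟩
  obtain ⟨i, hi⟩ := Function.ne_iff.1 (hψ0 w)
  have hi : ψ w i ≠ 0 := hi
  set τ := ‖ψ w i‖ ^ 2 / nsq (ψ w) with hτdef
  have hτ : 0 < τ := div_pos (by positivity) (nsq_pos (hψ0 w))
  set C : ℝ := Fintype.card ι * K with hC
  have hC0 : 0 ≤ C := by positivity
  set ρ := τ / (16 * (C + 1)) with hρdef
  have hρ : 0 < ρ := by positivity
  have hCρ : 2 * C * (2 * ρ) ≤ τ / 4 := by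
    have : 2 * C * (2 * ρ) = τ / 4 * (C / (C + 1)) := by rw [hρdef]; field_simp; ring
    rw [this]
    have : C / (C + 1) ≤ 1 := (div_le_one (by positivity)).2 (by linarith)
    nlinarith
  have hlow : ∀ᶠ n in (U : Filter ℕ), ∀ z ∈ ball w (2 * ρ),
      τ / 4 ≤ ‖g n z i‖ ^ 2 / nsq (g n z) := by
    have h1 : ∀ᶠ n in (U : Filter ℕ), τ / 2 < ‖g n w i‖ ^ 2 / nsq (g n w) :=
      (hθ w i).eventually (lt_mem_nhds (by linarith))
    have h2 : ∀ᶠ n : ℕ in (U : Filter ℕ), ‖w‖ + 2 * ρ ≤ n :=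
      Nat.hyperfilter_le_atTop (tendsto_natCast_atTop_atTop.eventually_ge_atTop _)
    filter_upwards [h1, h2] with n h1 h2 z hz
    have h3 := norm_sq_div_nsq_sub_le (hg n) (hg0 n) hK (fun y hy => hD n y (by
      rw [mem_ball_zero_iff]
      rw [mem_ball_iff_norm] at hy
      have := norm_le_norm_add_norm_sub' y w
      linarith)) hz i
    rw [mem_ball_iff_norm] at hz
    have h4 : 2 * Fintype.card ι * (K * ‖z - w‖) ≤ τ / 4 := by
      refine le_trans ?_ hCρ
      calc _ = 2 * C * ‖z - w‖ := by rw [hC]; ring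
        _ ≤ _ := by gcongr
    have h5 := (abs_le.1 (h3.trans h4)).1
    linarith
  refine ⟨i, ρ, hρ, √(4 / τ), ?_, fun z hz => ?_⟩
  · filter_upwards [hlow] with n hn z hz
    have h1 := hn z hz
    have hN := nsq_pos (hg0 n z)
    have hne : g n z i ≠ 0 := by
      intro h0
      rw [h0] at h1
      simp at h1
      linarith
    refine ⟨hne, (pi_norm_le_iff_of_nonneg (Real.sqrt_nonneg _)).2 fun j => ?_⟩
    refine Real.le_sqrt_of_sq_le ?_
    have h2 : 0 < ‖g n z i‖ := norm_pos_iff.2 hne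
    have h3 := norm_sq_le_nsq (g n z) j
    rw [le_div_iff₀ hN] at h1
    rw [Pi.smul_apply, smul_eq_mul, norm_mul, norm_inv, mul_pow, inv_pow, inv_mul_eq_div,
      div_le_div_iff₀ (by positivity) hτ]
    nlinarith
  · have hz2 : z ∈ ball w (2 * ρ) := ball_subset_ball (by linarith) hz
    have h1 : τ / 4 ≤ ‖ψ z i‖ ^ 2 / nsq (ψ z) :=
      ge_of_tendsto (hθ z i) (hlow.mono fun n hn => hn z hz2)
    have hne : ψ z i ≠ 0 := by
      intro h0
      rw [h0] at h1
      simp at h1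
      linarith
    refine ⟨hne, ?_⟩
    have h2 := ((((continuous_apply i).tendsto _).comp (hψ z)).inv₀ hne).smul (hψ z)
    refine h2.congr fun n => ?_
    have := hc n z
    simp only [Function.comp_apply, Pi.smul_apply, smul_eq_mul, smul_smul]
    congr 1
    field_simp

namespace IsChartLimit

variable {κ : Type*} {g : κ → ℂ → ι → ℂ} {l : Filter κ} {ψ : ℂ → ι → ℂ}

lemma ne_zero (h : IsChartLimit g l ψ) (w : ℂ) : ψ w ≠ 0 := by
  obtain ⟨i, ρ, hρ, -, -, h2⟩ := h w
  exact fun h0 => (h2 w (mem_ball_self hρ)).1 (congrFun h0 i)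

variable [l.NeBot]

/-- The local form of a chart limit. -/
lemma exists_chart (h : IsChartLimit g l ψ) (hg : ∀ n, Differentiable ℂ (g n)) (w : ℂ) :
    ∃ i, ∃ ρ > 0, ∃ M : ℝ,
      (∀ᶠ n in l, ∀ z ∈ ball w (2 * ρ), g n z i ≠ 0 ∧ ‖(g n z i)⁻¹ • g n z‖ ≤ M) ∧
      (∀ᶠ n in l, DifferentiableOn ℂ (fun z => (g n z i)⁻¹ • g n z) (ball w (2 * ρ))) ∧
      (∀ z ∈ ball w ρ, ψ z i ≠ 0) ∧
      TendstoLocallyUniformlyOn (fun n z => (g n z i)⁻¹ • g n z) (fun z => (ψ z i)⁻¹ • ψ z) l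
        (ball w ρ) := by
  obtain ⟨i, ρ, hρ, M, h1, h2⟩ := h w
  have hd : ∀ᶠ n in l, DifferentiableOn ℂ (fun z => (g n z i)⁻¹ • g n z) (ball w (2 * ρ)) := by
    filter_upwards [h1] with n hn z hz
    have := differentiableAt_pi.1 (hg n z) i
    exact ((this.inv (hn z hz).1).smul (hg n z)).differentiableWithinAt
  exact ⟨i, ρ, hρ, M, h1, hd, fun z hz => (h2 z hz).1, tendstoLocallyUniformlyOn_of_bounded hd
    (h1.mono fun n hn z hz => (hn z hz).2) fun z hz => (h2 z hz).2⟩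

lemma isHolCurve (h : IsChartLimit g l ψ) (hg : ∀ n, Differentiable ℂ (g n)) : IsHolCurve ψ := by
  intro w
  obtain ⟨i, ρ, hρ, M, -, hd, h0, hu⟩ := h.exists_chart hg w
  have hsub : ball w ρ ⊆ ball w (2 * ρ) := ball_subset_ball (by linarith)
  have hw := h0 w (mem_ball_self hρ)
  refine ⟨_, (hu.differentiableOn (hd.mono fun n hn => hn.mono hsub) isOpen_ball).analyticAt
    (ball_mem_nhds w hρ), smul_ne_zero (inv_ne_zero hw) (h.ne_zero w), ?_⟩
  filter_upwards [ball_mem_nhds w hρ] with z hz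
  exact ⟨ψ z i, h0 z hz, by rw [smul_smul, mul_inv_cancel₀ (h0 z hz), one_smul]⟩

lemma exists_ne (h : IsChartLimit g l ψ) (hg : ∀ n, Differentiable ℂ (g n))
    (h0 : ∀ n, nsq (g n 0) ^ 2 ≤ wsq (g n 0) (deriv (g n) 0)) :
    ∃ w w' i j, ψ w i * ψ w' j ≠ ψ w j * ψ w' i := by
  obtain ⟨i, ρ, hρ, M, h1, hd, hne, hu⟩ := h.exists_chart hg 0
  have hsub : ball (0 : ℂ) ρ ⊆ ball 0 (2 * ρ) := ball_subset_ball (by linarith)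
  have h0ρ : (0 : ℂ) ∈ ball (0 : ℂ) ρ := mem_ball_self hρ
  have hder := (hu.deriv (hd.mono fun n hn => hn.mono hsub) isOpen_ball).tendsto_at h0ρ
  have hval := hu.tendsto_at h0ρ
  have hw := (continuous_wsq.tendsto _).comp (hval.prodMk_nhds hder)
  have hge : (1 : ℝ) ≤ wsq ((ψ 0 i)⁻¹ • ψ 0) (deriv (fun z => (ψ z i)⁻¹ • ψ z) 0) := by
    refine ge_of_tendsto hw ?_
    filter_upwards [h1] with n hn
    have hn0 := (hn 0 (hsub h0ρ)).1
    have hdi := (differentiableAt_pi.1 (hg n 0) i).inv hn0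
    have e1 : deriv (fun z => (g n z i)⁻¹ • g n z) 0 = _ :=
      (hdi.hasDerivAt.smul (hg n 0).hasDerivAt).deriv
    simp only [Function.comp_apply]
    rw [e1, add_comm]
    erw [wsq_smul_add]
    have h2 := h0 n
    have h3 := norm_sq_le_nsq (g n 0) i
    have h4 : 0 < ‖g n 0 i‖ := norm_pos_iff.2 hn0
    have h5 : (‖g n 0 i‖ ^ 2) ^ 2 ≤ wsq (g n 0) (deriv (g n) 0) :=
      le_trans (by gcongr) h2
    calc (1 : ℝ) = ‖(g n 0 i)⁻¹‖ ^ 4 * (‖g n 0 i‖ ^ 2) ^ 2 := by rw [norm_inv]; field_simp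
      _ ≤ _ := by gcongr
  by_contra! hpar
  have hconst : (fun z => (ψ z i)⁻¹ • ψ z) =ᶠ[𝓝 0] fun _ => (ψ 0 i)⁻¹ • ψ 0 := by
    filter_upwards [ball_mem_nhds 0 hρ] with z hz
    funext j
    have a1 := hne z hz
    have a2 := hne 0 h0ρ
    have := hpar z 0 i j
    simp only [Pi.smul_apply, smul_eq_mul]
    field_simp
    linear_combination -this
  rw [hconst.deriv_eq, deriv_const] at hge
  have : wsq ((ψ 0 i)⁻¹ • ψ 0) 0 = 0 := by simp [wsq]
  linarith

end IsChartLimit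

end

/-- A Hurwitz type argument: a zero of `b` cannot be isolated if, in the approximating equations
`aₙ bₙ + tₙ eₙ = 0`, the functions `eₙ` do not vanish near it. -/
lemma eventually_eq_zero_of_mul_add_mul_eq_zero {κ : Type*} {l : Filter κ} [l.NeBot]
    {a b e : κ → ℂ → ℂ} {B E : ℂ → ℂ} {t : κ → ℂ} {U : Set ℂ} {w : ℂ} (hU : U ∈ 𝓝 w)
    (hUo : IsOpen U)
    (hbd : ∀ᶠ n in l, DifferentiableOn ℂ (b n) U) (hed : ∀ᶠ n in l, DifferentiableOn ℂ (e n) U)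
    (hb : TendstoLocallyUniformlyOn b B l U) (he : TendstoLocallyUniformlyOn e E l U)
    (ht : ∀ n, t n ≠ 0) (h : ∀ᶠ n in l, ∀ z ∈ U, a n z * b n z + t n * e n z = 0)
    (hB : B w = 0) (hE : E w ≠ 0) : ∀ᶠ z in 𝓝 w, B z = 0 := by
  have hBd := hb.differentiableOn hbd hUo
  have hEd := he.differentiableOn hed hUo
  refine (hBd.analyticAt hU).eventually_eq_zero_or_eventually_ne_zero.resolve_right fun hne => ?_
  have hEc := (hEd.analyticAt hU).continuousAt.eventually_ne hE
  obtain ⟨r, hr, hrs⟩ := Metric.nhds_basis_closedBall.mem_iff.1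
    (inter_mem (inter_mem hU hEc) (eventually_nhdsWithin_iff.1 hne))
  have hrU : closedBall w r ⊆ U := fun z hz => (hrs hz).1.1
  have huni : ∀ {f : κ → ℂ → ℂ} {F : ℂ → ℂ}, TendstoLocallyUniformlyOn f F l U →
      TendstoUniformlyOn f F l (closedBall w r) := fun hf =>
    (tendstoLocallyUniformlyOn_iff_forall_isCompact hUo).1 hf _ hrU (isCompact_closedBall w r)
  obtain ⟨x, hx, hxmin⟩ := (isCompact_sphere w r).exists_isMinOn
    (NormedSpace.sphere_nonempty.2 hr.le)
    ((hBd.continuousOn.mono hrU).mono sphere_subset_closedBall).norm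
  obtain ⟨y, hy, hymin⟩ := (isCompact_closedBall w r).exists_isMinOn ⟨w, mem_closedBall_self hr.le⟩
    (hEd.continuousOn.mono hrU).norm
  have hδ : 0 < ‖B x‖ := norm_pos_iff.2
    ((hrs (sphere_subset_closedBall hx)).2 (ne_of_mem_sphere hx hr.ne'))
  have hη : 0 < ‖E y‖ := norm_pos_iff.2 (hrs hy).1.2
  have hw0 : w ∈ closedBall w r := mem_closedBall_self hr.le
  have hbw : ∀ᶠ n in l, ‖B x‖ / 2 ≤ ‖b n w‖ := by
    filter_upwards [Metric.tendstoUniformlyOn_iff.1 (huni hb) (‖B x‖ / 2) (by positivity),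
      Metric.tendstoUniformlyOn_iff.1 (huni he) ‖E y‖ hη, hbd, h] with n h1 h2 h3 h4
    have hb0 : ∀ z ∈ closedBall w r, b n z ≠ 0 := by
      intro z hz h0
      have h5 := h4 z (hrU hz)
      rw [h0, mul_zero, zero_add] at h5
      have h6 := h2 z hz
      rw [(mul_eq_zero.1 h5).resolve_left (ht n), dist_zero_right] at h6
      exact h6.not_ge (hymin hz)
    have hsph : ∀ z ∈ sphere w r, ‖(b n z)⁻¹‖ ≤ (‖B x‖ / 2)⁻¹ := by
      intro z hz
      have h5 := h1 z (sphere_subset_closedBall hz)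
      have h6 : ‖B x‖ ≤ ‖B z‖ := hxmin hz
      rw [dist_eq_norm] at h5
      have := norm_sub_norm_le (B z) (b n z)
      rw [norm_inv]
      gcongr
      linarith
    have hmax := Complex.norm_le_of_forall_mem_frontier_norm_le (f := fun z => (b n z)⁻¹)
      (U := ball w r) isBounded_ball
      (DifferentiableOn.diffContOnCl (by
        rw [closure_ball _ hr.ne']
        exact (h3.mono hrU).inv hb0))
      (by rwa [frontier_ball _ hr.ne']) (subset_closure (mem_ball_self hr))
    rw [norm_inv] at hmax
    exact (inv_le_inv₀ (norm_pos_iff.2 (hb0 w hw0)) (by positivity)).1 hmax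
  have := ge_of_tendsto ((huni hb).tendsto_at hw0).norm hbw
  rw [hB, norm_zero] at this
  linarith

section

variable {ι κ : Type*} [Fintype ι] {l : Filter κ} [l.NeBot]

lemma tendstoLocallyUniformlyOn_eval {G : κ → ℂ → ι → ℂ} {H : ℂ → ι → ℂ} {w : ℂ} {ρ M : ℝ}
    (hρ : 0 < ρ) (hd : ∀ᶠ n in l, DifferentiableOn ℂ (G n) (ball w (2 * ρ)))
    (hM : ∀ᶠ n in l, ∀ z ∈ ball w (2 * ρ), ‖G n z‖ ≤ M)
    (hu : TendstoLocallyUniformlyOn G H l (ball w ρ)) (F : MvPolynomial ι ℂ) :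
    (∀ᶠ n in l, DifferentiableOn ℂ (fun z => eval (G n z) F) (ball w ρ)) ∧
      TendstoLocallyUniformlyOn (fun n z => eval (G n z) F) (fun z => eval (H z) F) l
        (ball w ρ) := by
  have h1 : ∀ᶠ n in l, DifferentiableOn ℂ (fun z => eval (G n z) F) (ball w (2 * ρ)) := by
    filter_upwards [hd] with n hn z hz
    exact ((hn.differentiableAt (isOpen_ball.mem_nhds hz)).hasDerivAt.eval_mvPolynomial
      F).differentiableAt.differentiableWithinAt
  refine ⟨h1.mono fun n hn => hn.mono (ball_subset_ball (by linarith)), ?_⟩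
  obtain ⟨C, hC⟩ := (isCompact_closedBall (0 : ι → ℂ) M).exists_bound_of_continuousOn
    (MvPolynomial.continuous_eval F).continuousOn
  refine tendstoLocallyUniformlyOn_of_bounded (M := C) h1 ?_ fun z hz =>
    ((MvPolynomial.continuous_eval F).tendsto _).comp (hu.tendsto_at hz)
  filter_upwards [hM] with n hn z hz
  exact hC _ (mem_closedBall_zero_iff.2 (hn z hz))

variable {g : κ → ℂ → ι → ℂ} {ψ : ℂ → ι → ℂ} {A B E : MvPolynomial ι ℂ} {m n : ℕ} {t : κ → ℂ}

lemma eval_smul_mul_add (hA : A.IsHomogeneous m) (hB : B.IsHomogeneous n)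
    (hE : E.IsHomogeneous (m + n)) {x : ι → ℂ} {s : ℂ}
    (h : eval x A * eval x B + s * eval x E = 0) (c : ℂ) :
    eval (c • x) A * eval (c • x) B + s * eval (c • x) E = 0 := by
  rw [hA.eval_smul, hB.eval_smul, hE.eval_smul, pow_add]
  linear_combination c ^ m * c ^ n * h

/-- The limit lies on the limit surface. -/
lemma IsChartLimit.eval_mul_eval_eq_zero (hψ : IsChartLimit g l ψ)
    (hA : A.IsHomogeneous m) (hB : B.IsHomogeneous n) (hE : E.IsHomogeneous (m + n))
    (ht : Tendsto t l (𝓝 0))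
    (h : ∀ k w, eval (g k w) A * eval (g k w) B + t k * eval (g k w) E = 0) (w : ℂ) :
    eval (ψ w) A * eval (ψ w) B = 0 := by
  obtain ⟨i, ρ, hρ, M, -, h2⟩ := hψ w
  obtain ⟨h0, hlim⟩ := h2 w (mem_ball_self hρ)
  have hF : ∀ F : MvPolynomial ι ℂ, Tendsto (fun k => eval ((g k w i)⁻¹ • g k w) F) l
      (𝓝 (eval ((ψ w i)⁻¹ • ψ w) F)) := fun F =>
    ((MvPolynomial.continuous_eval F).tendsto _).comp hlim
  have := tendsto_nhds_unique (((hF A).mul (hF B)).add (ht.mul (hF E)))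
    (tendsto_const_nhds.congr fun k => (eval_smul_mul_add hA hB hE (h k w) _).symm)
  rw [zero_mul, add_zero] at this
  rwa [mul_eq_zero, hA.eval_smul_eq_zero_iff (inv_ne_zero h0),
    hB.eval_smul_eq_zero_iff (inv_ne_zero h0), ← mul_eq_zero] at this

/-- The limit curve meets `B = 0` outside `E = 0` only if it is contained in `B = 0`. -/
lemma IsChartLimit.eventually_eval_eq_zero (hψ : IsChartLimit g l ψ)
    (hg : ∀ k, Differentiable ℂ (g k))
    (hA : A.IsHomogeneous m) (hB : B.IsHomogeneous n) (hE : E.IsHomogeneous (m + n))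
    (ht : ∀ k, t k ≠ 0)
    (h : ∀ k w, eval (g k w) A * eval (g k w) B + t k * eval (g k w) E = 0) {w : ℂ}
    (hBw : eval (ψ w) B = 0) (hEw : eval (ψ w) E ≠ 0) : ∀ᶠ z in 𝓝 w, eval (ψ z) B = 0 := by
  obtain ⟨i, ρ, hρ, M, hM, hd, h0, hu⟩ := hψ.exists_chart hg w
  have hF := tendstoLocallyUniformlyOn_eval hρ hd (hM.mono fun k hk z hz => (hk z hz).2) hu
  have h0w := inv_ne_zero (h0 w (mem_ball_self hρ))
  have := eventually_eq_zero_of_mul_add_mul_eq_zero (ball_mem_nhds w hρ) isOpen_ball (hF B).1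
    (hF E).1 (hF B).2 (hF E).2 ht
    (Eventually.of_forall fun k z _ => eval_smul_mul_add hA hB hE (h k z) _)
    ((hB.eval_smul_eq_zero_iff h0w _).2 hBw) (fun h1 => hEw ((hE.eval_smul_eq_zero_iff h0w _).1 h1))
  filter_upwards [this, ball_mem_nhds w hρ] with z hz hzρ
  exact (hB.eval_smul_eq_zero_iff (inv_ne_zero (h0 z hzρ)) _).1 hz

end

section

variable {ι : Type*} [Fintype ι]

/-- Two values of a map with vanishing Fubini-Study derivative are linearly dependent. -/
lemma not_linearIndependent_of_wsq_eq_zero {g : ℂ → ι → ℂ} (hg : Differentiable ℂ g)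
    (hg0 : ∀ w, g w ≠ 0) (h : ∀ w, wsq (g w) (deriv g w) = 0) (w w' : ℂ) :
    ¬ LinearIndependent ℂ ![g w, g w'] := by
  obtain ⟨v, hv0, hv⟩ := exists_eventually_eq_smul (P := g) fun w => by
    obtain ⟨v, hv, h1⟩ := exists_eventuallyEq_smul_of_wsq_eq_zero (hg.analyticAt w) (hg0 w)
      (Eventually.of_forall h)
    exact ⟨v, hv, nhdsWithin_le_nhds h1⟩
  obtain ⟨i, hi⟩ := Function.ne_iff.1 hv0
  have hi : v i ≠ 0 := hi
  have hgv : ∀ w, v i • g w = g w i • v := by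
    intro w
    have h1 : Tendsto (fun z => v i • g z) (𝓝[≠] w) (𝓝 (v i • g w)) :=
      ((hg.continuous.tendsto w).mono_left nhdsWithin_le_nhds).const_smul _
    have h2 : Tendsto (fun z => g z i • v) (𝓝[≠] w) (𝓝 (g w i • v)) :=
      ((((continuous_apply i).comp hg.continuous).tendsto w).mono_left
        nhdsWithin_le_nhds).smul_const v
    refine tendsto_nhds_unique h1 (h2.congr' ?_)
    filter_upwards [hv w] with z ⟨c, _, hc⟩
    rw [hc, Pi.smul_apply, smul_eq_mul, smul_smul, mul_comm]
  intro hli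
  have h0 := LinearIndependent.pair_iff.1 hli (v i * g w' i) (-(v i * g w i)) (by
    have a := hgv w
    have b := hgv w'
    funext j
    have aj := congrFun a j
    have bj := congrFun b j
    simp only [Pi.smul_apply, smul_eq_mul, Pi.add_apply, Pi.zero_apply] at aj bj ⊢
    linear_combination g w' i * aj - g w i * bj)
  have h1 := hgv w
  rw [(mul_eq_zero.1 (neg_eq_zero.1 h0.2)).resolve_left hi, zero_smul] at h1
  exact (smul_ne_zero hi (hg0 w)) h1

/-- Brody's reparametrization lemma. -/
lemma exists_brody_reparametrization {g : ℂ → ι → ℂ} (hg : Differentiable ℂ g)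
    (hg0 : ∀ w, g w ≠ 0) {w₀ : ℂ} (h : wsq (g w₀) (deriv g w₀) ≠ 0) {N : ℝ} (hN : 0 < N) :
    ∃ a d : ℂ, nsq (g a) ^ 2 ≤ wsq (g a) (d • deriv g a) ∧
      ∀ ζ ∈ ball (0 : ℂ) N, wsq (g (a + ζ * d)) (d • deriv g (a + ζ * d)) ≤
        2 ^ 2 * nsq (g (a + ζ * d)) ^ 2 := by
  set s : ℂ → ℝ := fun w => √(wsq (g w) (deriv g w)) / nsq (g w) with hs
  have hpos : ∀ w, 0 < nsq (g w) := fun w => nsq_pos (hg0 w)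
  have hg' : Continuous (deriv g) := (hg.contDiff (n := 1)).continuous_deriv le_rfl
  have hsc : Continuous s :=
    ((continuous_wsq.comp (hg.continuous.prodMk hg')).sqrt).div
      (continuous_nsq.comp hg.continuous) fun w => (hpos w).ne'
  have hs0 : ∀ w, 0 ≤ s w := fun w => div_nonneg (Real.sqrt_nonneg _) (hpos w).le
  have hsq : ∀ w, wsq (g w) (deriv g w) = s w ^ 2 * nsq (g w) ^ 2 := by
    intro w
    have := (hpos w).ne'
    rw [hs]
    field_simp
    rw [Real.sq_sqrt (wsq_nonneg _ _)]
  have hsw : 0 < s w₀ :=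
    div_pos (Real.sqrt_pos.2 ((wsq_nonneg _ _).lt_of_ne' h)) (hpos w₀)
  set R := 2 * N / s w₀ with hR
  have hR0 : 0 < R := by positivity
  obtain ⟨a, ha, hmax⟩ := (isCompact_closedBall w₀ R).exists_isMaxOn
    ⟨w₀, mem_closedBall_self hR0.le⟩
    (f := fun w => s w * (R - ‖w - w₀‖)) (by fun_prop)
  have h2N : 2 * N ≤ s a * (R - ‖a - w₀‖) := by
    have : s w₀ * (R - ‖w₀ - w₀‖) ≤ s a * (R - ‖a - w₀‖) := hmax (mem_closedBall_self hR0.le)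
    refine le_trans (le_of_eq ?_) this
    rw [sub_self, norm_zero, sub_zero, hR]
    field_simp
  rw [mem_closedBall_iff_norm] at ha
  have hsa : 0 < s a := by
    rcases (hs0 a).eq_or_lt with h0 | h0
    · rw [← h0] at h2N; linarith
    · exact h0
  have hsmul : ∀ w, wsq (g w) (((s a)⁻¹ : ℂ) • deriv g w) = (s w / s a) ^ 2 * nsq (g w) ^ 2 := by
    intro w
    have h2 : wsq (g w) (((s a)⁻¹ : ℂ) • deriv g w) =
        ‖((s a)⁻¹ : ℂ)‖ ^ 2 * wsq (g w) (deriv g w) := by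
      simp only [wsq, Finset.mul_sum, ← mul_pow, ← norm_mul, Pi.smul_apply, smul_eq_mul]
      refine Finset.sum_congr rfl fun i _ => Finset.sum_congr rfl fun j _ => ?_
      congr 2
      ring
    rw [h2, hsq, norm_inv, Complex.norm_real, Real.norm_of_nonneg hsa.le]
    field_simp
  refine ⟨a, ((s a)⁻¹ : ℂ), ?_, fun ζ hζ => ?_⟩
  · rw [hsmul, div_self hsa.ne', one_pow, one_mul]
  · rw [hsmul]
    rw [mem_ball_zero_iff] at hζ
    set z := a + ζ * ((s a)⁻¹ : ℂ) with hz
    have h3 : ‖z - a‖ = ‖ζ‖ / s a := by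
      rw [hz, add_sub_cancel_left, norm_mul, norm_inv, Complex.norm_real,
        Real.norm_of_nonneg hsa.le, div_eq_mul_inv]
    have h4 : ‖ζ‖ / s a ≤ (R - ‖a - w₀‖) / 2 := by
      rw [div_le_div_iff₀ hsa two_pos]
      nlinarith
    have h5 : ‖z - w₀‖ ≤ ‖z - a‖ + ‖a - w₀‖ := norm_sub_le_norm_sub_add_norm_sub _ _ _
    have h7 : 0 < R - ‖a - w₀‖ := by
      by_contra! h8
      nlinarith
    have h6 : s z * (R - ‖z - w₀‖) ≤ s a * (R - ‖a - w₀‖) :=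
      hmax (mem_closedBall_iff_norm.2 (by linarith))
    have h9 : s z / s a ≤ 2 := by
      rw [div_le_iff₀ hsa]
      have : s z * ((R - ‖a - w₀‖) / 2) ≤ s a * (R - ‖a - w₀‖) :=
        le_trans (mul_le_mul_of_nonneg_left (by linarith) (hs0 z)) h6
      nlinarith
    have := div_nonneg (hs0 z) hsa.le
    gcongr

end

/-- If arbitrarily small `t` admit an entire curve with independent values satisfying `P t`, then
reparametrizations of such curves have a nonconstant limit. -/
lemma exists_isChartLimit_of_forall {ι : Type*} [Fintype ι] {P : ℂ → (ι → ℂ) → Prop}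
    (h : ∀ ε > (0 : ℝ), ∃ t : ℂ, 0 < ‖t‖ ∧ ‖t‖ < ε ∧ ∃ g : ℂ → ι → ℂ, Differentiable ℂ g ∧
      (∀ w, g w ≠ 0) ∧ (∀ w, P t (g w)) ∧ ∃ w w', LinearIndependent ℂ ![g w, g w']) :
    ∃ (t : ℕ → ℂ) (g : ℕ → ℂ → ι → ℂ) (ψ : ℂ → ι → ℂ),
      (∀ k, t k ≠ 0) ∧ Tendsto t (hyperfilter ℕ : Filter ℕ) (𝓝 0) ∧
      (∀ k, Differentiable ℂ (g k)) ∧ (∀ k w, P (t k) (g k w)) ∧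
      IsChartLimit g (hyperfilter ℕ : Filter ℕ) ψ ∧
      ∃ w w' i j, ψ w i * ψ w' j ≠ ψ w j * ψ w' i := by
  have key : ∀ k : ℕ, ∃ (t : ℂ) (g : ℂ → ι → ℂ), t ≠ 0 ∧ ‖t‖ ≤ 1 / ((k : ℝ) + 1) ∧
      Differentiable ℂ g ∧ (∀ w, g w ≠ 0) ∧ (∀ w, P t (g w)) ∧
      nsq (g 0) ^ 2 ≤ wsq (g 0) (deriv g 0) ∧
      ∀ ζ ∈ ball (0 : ℂ) k, wsq (g ζ) (deriv g ζ) ≤ 2 ^ 2 * nsq (g ζ) ^ 2 := by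
    intro k
    obtain ⟨t, ht0, ht, g, hg, hg0, hP, w, w', hli⟩ := h (1 / ((k : ℝ) + 1)) (by positivity)
    obtain ⟨w₀, hw₀⟩ : ∃ w, wsq (g w) (deriv g w) ≠ 0 := by
      by_contra! h0
      exact not_linearIndependent_of_wsq_eq_zero hg hg0 h0 w w' hli
    obtain ⟨a, d, h1, h2⟩ := exists_brody_reparametrization hg hg0 hw₀
      (N := k + 1) (by positivity)
    have hlin : ∀ ζ, HasDerivAt (fun ζ => a + ζ * d) d ζ := fun ζ => by
      simpa using ((hasDerivAt_id ζ).mul_const d).const_add a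
    have hd : ∀ ζ, HasDerivAt (fun ζ => g (a + ζ * d)) (d • deriv g (a + ζ * d)) ζ :=
      fun ζ => (hg _).hasDerivAt.scomp ζ (hlin ζ)
    refine ⟨t, fun ζ => g (a + ζ * d), norm_pos_iff.1 ht0, ht.le,
      fun ζ => (hd ζ).differentiableAt, fun ζ => hg0 _, fun ζ => hP _, ?_, fun ζ hζ => ?_⟩
    · rw [(hd 0).deriv]
      simpa using h1
    · rw [(hd ζ).deriv]
      exact h2 ζ (ball_subset_ball (by linarith) hζ)
  choose t g ht0 ht hg hg0 hP h0 hD using key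
  obtain ⟨ψ, hψ⟩ := exists_isChartLimit hg hg0 zero_le_two hD
  refine ⟨t, g, ψ, ht0, ?_, hg, hP, hψ, hψ.exists_ne hg h0⟩
  exact (squeeze_zero_norm ht tendsto_one_div_add_atTop_nhds_zero_nat).mono_left
    Nat.hyperfilter_le_atTop

lemma eval_rename_zero_one_two (v : Fin 4 → ℂ) (f : MvPolynomial (Fin 3) ℂ) :
    eval v (rename ![0, 1, 2] f) = eval ![v 0, v 1, v 2] f := by
  rw [eval_rename]
  congr 2
  funext i
  fin_cases i <;> rfl

lemma LinearIndependent.pair_comp_equiv {ι : Type*} {v w : ι → ℂ} (σ : Equiv.Perm ι)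
    (h : LinearIndependent ℂ ![v, w]) : LinearIndependent ℂ ![v ∘ σ, w ∘ σ] := by
  rw [LinearIndependent.pair_iff] at h ⊢
  intro s t hst
  refine h s t ?_
  funext i
  simpa using congrFun hst (σ.symm i)

lemma IsHolCurve.comp_equiv {ι : Type*} [Fintype ι] {ψ : ℂ → ι → ℂ} (hψ : IsHolCurve ψ)
    (σ : Equiv.Perm ι) : IsHolCurve fun w => ψ w ∘ σ := by
  intro w
  obtain ⟨q, hq, hq0, h⟩ := hψ w
  refine ⟨fun z => q z ∘ σ, ?_, ?_, ?_⟩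
  · exact AnalyticAt.pi fun i => analyticAt_pi_iff.1 hq (σ i)
  · intro h0
    refine hq0 (funext fun i => ?_)
    simpa using congrFun h0 (σ.symm i)
  · filter_upwards [h] with z ⟨c, hc, hz⟩
    exact ⟨c, hc, by rw [hz]; rfl⟩

end

/-- A general small deformation
`X_t = {f₁(z₁,z₂,z₃) f₂(z₁,z₂,z₄) + t f_∞ = 0}` of the union of two general cones of
degrees `m, n ≥ 4` in `ℙ³` is Brody hyperbolic: every entire curve lifted to
`ℂ⁴ ∖ {0}` has pairwise linearly dependent values. -/
theorem deformation_of_two_cones_is_hyperbolic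
    (m n : ℕ) (hm : 4 ≤ m) (hn : 4 ≤ n)
    (f₁ f₂ : MvPolynomial (Fin 3) ℂ)
    (hf₁hom : f₁.IsHomogeneous m) (hf₂hom : f₂.IsHomogeneous n)
    -- (i) the vertices avoid the opposite cones
    (hf₁v : eval ![0, 0, 1] f₁ ≠ 0) (hf₂v : eval ![0, 0, 1] f₂ ≠ 0)
    -- (ii) the base curves are smooth
    (hf₁sm : ∀ x : Fin 3 → ℂ, x ≠ 0 → eval x f₁ = 0 → ∃ i, eval x (pderiv i f₁) ≠ 0)
    (hf₂sm : ∀ x : Fin 3 → ℂ, x ≠ 0 → eval x f₂ = 0 → ∃ i, eval x (pderiv i f₂) ≠ 0)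
    -- (iii) every fiber of the projection of each base curve has at least 3 points
    (hf₁3 : ∀ x₁ x₂ : ℂ, (x₁, x₂) ≠ 0 → ∃ t₁ t₂ t₃ : ℂ, t₁ ≠ t₂ ∧ t₁ ≠ t₃ ∧ t₂ ≠ t₃ ∧
      eval ![x₁, x₂, t₁] f₁ = 0 ∧ eval ![x₁, x₂, t₂] f₁ = 0 ∧ eval ![x₁, x₂, t₃] f₁ = 0)
    (hf₂3 : ∀ x₁ x₂ : ℂ, (x₁, x₂) ≠ 0 → ∃ s₁ s₂ s₃ : ℂ, s₁ ≠ s₂ ∧ s₁ ≠ s₃ ∧ s₂ ≠ s₃ ∧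
      eval ![x₁, x₂, s₁] f₂ = 0 ∧ eval ![x₁, x₂, s₂] f₂ = 0 ∧ eval ![x₁, x₂, s₃] f₂ = 0)
    (finf : MvPolynomial (Fin 4) ℂ) (hfinfhom : finf.IsHomogeneous (m + n))
    -- (iv) every ruling line ⟨p,a⟩ of the first cone carries at least 3 points of the
    -- double curve Γ avoiding {f_∞ = 0}
    (hiv : ∀ p : Fin 3 → ℂ, p ≠ 0 → eval p f₁ = 0 →
      ∃ v₁ v₂ v₃ : Fin 4 → ℂ, v₁ ≠ 0 ∧ v₂ ≠ 0 ∧ v₃ ≠ 0 ∧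
        LinearIndependent ℂ ![v₁, v₂] ∧ LinearIndependent ℂ ![v₁, v₃] ∧
        LinearIndependent ℂ ![v₂, v₃] ∧
        (∀ v ∈ ({v₁, v₂, v₃} : Set (Fin 4 → ℂ)),
          v ∈ Submodule.span ℂ {![p 0, p 1, p 2, 0], ![0, 0, 0, 1]} ∧
          eval ![v 0, v 1, v 2] f₁ = 0 ∧ eval ![v 0, v 1, v 3] f₂ = 0 ∧ eval v finf ≠ 0))
    -- (v) same for the ruling lines ⟨q,b⟩ of the second cone
    (hv : ∀ q : Fin 3 → ℂ, q ≠ 0 → eval q f₂ = 0 →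
      ∃ v₁ v₂ v₃ : Fin 4 → ℂ, v₁ ≠ 0 ∧ v₂ ≠ 0 ∧ v₃ ≠ 0 ∧
        LinearIndependent ℂ ![v₁, v₂] ∧ LinearIndependent ℂ ![v₁, v₃] ∧
        LinearIndependent ℂ ![v₂, v₃] ∧
        (∀ v ∈ ({v₁, v₂, v₃} : Set (Fin 4 → ℂ)),
          v ∈ Submodule.span ℂ {![q 0, q 1, 0, q 2], ![0, 0, 1, 0]} ∧
          eval ![v 0, v 1, v 2] f₁ = 0 ∧ eval ![v 0, v 1, v 3] f₂ = 0 ∧ eval v finf ≠ 0)) :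
    ∃ ε > (0 : ℝ), ∀ t : ℂ, 0 < ‖t‖ → ‖t‖ < ε →
      ∀ g : ℂ → (Fin 4 → ℂ), Differentiable ℂ g → (∀ w, g w ≠ 0) →
        (∀ w, eval ![g w 0, g w 1, g w 2] f₁ * eval ![g w 0, g w 1, g w 3] f₂
          + t * eval (g w) finf = 0) →
        ∀ w w' : ℂ, ¬ LinearIndependent ℂ ![g w, g w'] := by
  by_contra! hcon
  obtain ⟨t, g, ψ, ht0, ht, hg, hP, hψ, w, w', i, j, hne⟩ := exists_isChartLimit_of_forall
    (P := fun t x => eval ![x 0, x 1, x 2] f₁ * eval ![x 0, x 1, x 3] f₂ + t * eval x finf = 0)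
    hcon
  simp only [← eval_rename_zero_one_two, ← eval_rename_zero_one_three] at hP
  have hA : (rename (![0, 1, 2] : Fin 3 → Fin 4) f₁).IsHomogeneous m := hf₁hom.rename_isHomogeneous
  have hB : (rename (![0, 1, 3] : Fin 3 → Fin 4) f₂).IsHomogeneous n := hf₂hom.rename_isHomogeneous
  have hhol := hψ.isHolCurve hg
  rcases hhol.eval_eq_zero_or hA hB (hψ.eval_mul_eval_eq_zero hA hB hfinfhom ht hP) with h0 | h0
  · simp only [eval_rename_zero_one_two] at h0
    refine hhol.false_of_cone hm hf₁hom hf₁sm hf₂hom hf₂v (N := fun v => eval v finf ≠ 0)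
      (fun c hc v h => (hfinfhom.eval_smul_eq_zero_iff hc v).not.2 h) (fun p hp hfp => ?_)
      hψ.ne_zero h0 (fun w hN h1 => ?_) hne
    · obtain ⟨v₁, v₂, v₃, -, -, -, h12, h13, h23, h⟩ := hiv p hp hfp
      exact ⟨v₁, v₂, v₃, h12, h13, h23, fun v hvv => ⟨(h v hvv).1, (h v hvv).2.2⟩⟩
    · rw [← eval_rename_zero_one_three] at h1
      simpa only [eval_rename_zero_one_three] using
        hψ.eventually_eval_eq_zero hg hA hB hfinfhom ht0 hP h1 hN
  · simp only [eval_rename_zero_one_three] at h0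
    set σ : Equiv.Perm (Fin 4) := Equiv.swap 2 3
    have hσσ : ∀ v : Fin 4 → ℂ, (v ∘ σ) ∘ σ = v := fun v => by
      funext k
      simp [σ]
    have hσ : ∀ v : Fin 4 → ℂ, v ∘ σ = ![v 0, v 1, v 3, v 2] := fun v => by
      funext k
      fin_cases k <;> rfl
    have hP' : ∀ k w, eval (g k w) (rename ![0, 1, 3] f₂) * eval (g k w) (rename ![0, 1, 2] f₁) +
        t k * eval (g k w) finf = 0 := fun k w => by rw [mul_comm (eval _ _)]; exact hP k w
    refine (hhol.comp_equiv σ).false_of_cone hn hf₂hom hf₂sm hf₁hom hf₁v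
      (N := fun v => eval (v ∘ σ) finf ≠ 0)
      (fun c hc v h => (hfinfhom.eval_smul_eq_zero_iff hc (v ∘ σ)).not.2 h) (fun q hq hfq => ?_)
      (fun w h => hψ.ne_zero w ?_) h0 (fun w hN h1 => ?_) (w := w) (w' := w') (i := σ i) (j := σ j)
      (by simpa [σ] using hne)
    · obtain ⟨v₁, v₂, v₃, -, -, -, h12, h13, h23, h⟩ := hv q hq hfq
      refine ⟨v₁ ∘ σ, v₂ ∘ σ, v₃ ∘ σ, h12.pair_comp_equiv σ, h13.pair_comp_equiv σ,
        h23.pair_comp_equiv σ, fun v hvv => ?_⟩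
      obtain ⟨u, hu, rfl⟩ : ∃ u ∈ ({v₁, v₂, v₃} : Set (Fin 4 → ℂ)), v = u ∘ σ := by
        rcases hvv with rfl | rfl | rfl
        exacts [⟨v₁, by simp, rfl⟩, ⟨v₂, by simp, rfl⟩, ⟨v₃, by simp, rfl⟩]
      obtain ⟨hs, h1, -, hN⟩ := h u hu
      refine ⟨?_, h1, by rwa [hσσ]⟩
      obtain ⟨a, b, rfl⟩ := Submodule.mem_span_pair.1 hs
      refine Submodule.mem_span_pair.2 ⟨a, b, ?_⟩
      rw [hσ]
      simp
    · rw [← hσσ (ψ w), h]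
      rfl
    · rw [hσσ] at hN
      have h2 : eval (ψ w) (rename ![0, 1, 2] f₁) = 0 := by
        rw [eval_rename_zero_one_two]; exact h1
      have := hψ.eventually_eval_eq_zero hg hB hA (by rwa [add_comm]) ht0 hP' h2 hN
      simp only [eval_rename_zero_one_two] at this
      exact this
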